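/- arXiv:2010.08945 — 6 statements merged into one kernel-verified Lean document; each statement's English description precedes it below -/
import Mathlib

section
/- Let φ(x,y) = a x² + 2 b x y + c y² be a positive definite real quadratic form (a > 0 and d := a c − b² > 0) and fix δ > 0. For y ≠ 0 define κ(y) = ∫_{−δ}^{δ} φ(x,y)⁻¹ dx. Then the function y ↦ κ(y) − π/(√d · |y|) is bounded on ℝ \ {0}; equivalently, there exists M > 0 such that |κ(y) − π/(√d |y|)| ≤ M for every y ≠ 0. -/
open scoped Real

theorem pi_div_two_sub_arctan_le_inv {t : ℝ} (ht : 0 < t) : π / 2 - Real.arctan t ≤ t⁻¹ := by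
  rw [← Real.arctan_inv_of_pos ht]
  have hpos : 0 < Real.arctan t⁻¹ := Real.arctan_pos.mpr (inv_pos.mpr ht)
  have h := Real.le_tan hpos.le (Real.arctan_lt_pi_div_two _)
  rwa [Real.tan_arctan] at h

/-- If `|e| ≤ β r`, then `(π / 2 - arctan ((A + e) / (s r))) / (s r)` is bounded uniformly
in `r > 0`. -/
theorem pi_div_two_sub_arctan_div_le {A s r β e : ℝ} (hA : 0 < A) (hs : 0 < s) (hr : 0 < r)
    (hβ : 0 ≤ β) (he : |e| ≤ β * r) :
    (π / 2 - Real.arctan ((A + e) / (s * r))) / (s * r) ≤ 2 / A + 2 * π * β / (s * A) := by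
  have hw : 0 < s * r := mul_pos hs hr
  have he' := (abs_le.mp he).1
  rcases le_total (β * r) (A / 2) with h | h
  · have hAe : A / 2 ≤ A + e := by linarith
    have ht : 0 < A + e := by linarith
    calc (π / 2 - Real.arctan ((A + e) / (s * r))) / (s * r)
        ≤ ((A + e) / (s * r))⁻¹ / (s * r) := by
          gcongr
          exact pi_div_two_sub_arctan_le_inv (div_pos ht hw)
      _ = 1 / (A + e) := by field_simp
      _ ≤ 1 / (A / 2) := by gcongr
      _ = 2 / A := by field_simp
      _ ≤ 2 / A + 2 * π * β / (s * A) := le_add_of_nonneg_right (by positivity)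
  · calc (π / 2 - Real.arctan ((A + e) / (s * r))) / (s * r)
        ≤ π / (s * r) := by
          gcongr
          linarith [Real.neg_pi_div_two_lt_arctan ((A + e) / (s * r))]
      _ ≤ 2 * π * β / (s * A) := by
          rw [div_le_div_iff₀ hw (by positivity)]
          have := mul_le_mul_of_nonneg_left h (mul_pos Real.pi_pos hs).le
          nlinarith
      _ ≤ 2 / A + 2 * π * β / (s * A) := le_add_of_nonneg_left (by positivity)

theorem integral_inv_quadratic_form {a b c : ℝ} (ha : 0 < a) (hd : 0 < a * c - b ^ 2) {y : ℝ}
    (hy : y ≠ 0) (u v : ℝ) :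
    ∫ x in u..v, (a * x ^ 2 + 2 * b * x * y + c * y ^ 2)⁻¹ =
      Real.arctan ((a * v + b * y) / (√(a * c - b ^ 2) * |y|)) / (√(a * c - b ^ 2) * |y|) -
        Real.arctan ((a * u + b * y) / (√(a * c - b ^ 2) * |y|)) / (√(a * c - b ^ 2) * |y|) := by
  have hw : 0 < √(a * c - b ^ 2) * |y| := mul_pos (Real.sqrt_pos.mpr hd) (abs_pos.mpr hy)
  have hw2 : (√(a * c - b ^ 2) * |y|) ^ 2 = (a * c - b ^ 2) * y ^ 2 := by
    rw [mul_pow, Real.sq_sqrt hd.le, sq_abs]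
  generalize √(a * c - b ^ 2) * |y| = w at hw hw2
  have hφ (x : ℝ) : 0 < a * x ^ 2 + 2 * b * x * y + c * y ^ 2 := by
    refine (mul_pos_iff_of_pos_left ha).mp ?_
    have : a * (a * x ^ 2 + 2 * b * x * y + c * y ^ 2) = (a * x + b * y) ^ 2 + w ^ 2 := by
      rw [hw2]; ring
    rw [this]
    positivity
  refine intervalIntegral.integral_eq_sub_of_hasDerivAt
    (f := fun x => Real.arctan ((a * x + b * y) / w) / w) (fun x _ => ?_) ?_
  · have h := (((((hasDerivAt_id x).const_mul a).add_const (b * y)).div_const w).arctan).div_const w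
    refine h.congr_deriv ?_
    have h1 : 1 + ((a * x + b * y) / w) ^ 2
        = a * (a * x ^ 2 + 2 * b * x * y + c * y ^ 2) / w ^ 2 := by
      rw [eq_div_iff (by positivity), add_mul, div_pow, div_mul_cancel₀ _ (by positivity), hw2]
      ring
    rw [id, h1]
    have := (hφ x).ne'
    field_simp
  · exact (Continuous.inv₀ (by fun_prop) fun x => (hφ x).ne').intervalIntegrable _ _

/-- For a positive definite quadratic form
`φ(x,y) = a x² + 2 b x y + c y²` (with `a > 0`, `d = a c − b² > 0`) and `δ > 0`,
the function `y ↦ κ(y) − π/(√d |y|)`, where `κ(y) = ∫_{−δ}^{δ} φ(x,y)⁻¹ dx`,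
is bounded on `ℝ \ {0}`. -/
theorem stmt_0 (a b c δ : ℝ) (ha : 0 < a) (hd : 0 < a * c - b ^ 2) (hδ : 0 < δ)
    (κ : ℝ → ℝ)
    (hκ : ∀ y : ℝ, y ≠ 0 →
      κ y = ∫ x in (-δ)..δ, (a * x ^ 2 + 2 * b * x * y + c * y ^ 2)⁻¹) :
    ∃ M > 0, ∀ y : ℝ, y ≠ 0 →
      |κ y - π / (Real.sqrt (a * c - b ^ 2) * |y|)| ≤ M := by
  have hs : 0 < √(a * c - b ^ 2) := Real.sqrt_pos.mpr hd
  have hA : 0 < a * δ := mul_pos ha hδ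
  refine ⟨2 * (2 / (a * δ) + 2 * π * |b| / (√(a * c - b ^ 2) * (a * δ))), by positivity,
    fun y hy => ?_⟩
  have hr : 0 < |y| := abs_pos.mpr hy
  rw [hκ y hy, integral_inv_quadratic_form ha hd hy]
  have h1 := pi_div_two_sub_arctan_div_le (e := b * y) hA hs hr (abs_nonneg b) (abs_mul b y).le
  have h2 := pi_div_two_sub_arctan_div_le (e := -(b * y)) hA hs hr (abs_nonneg b)
    (by rw [abs_neg, abs_mul])
  have hneg : (a * -δ + b * y) / (√(a * c - b ^ 2) * |y|)
      = -((a * δ + -(b * y)) / (√(a * c - b ^ 2) * |y|)) := by ring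
  rw [hneg, Real.arctan_neg]
  have hw : 0 < √(a * c - b ^ 2) * |y| := mul_pos hs hr
  generalize √(a * c - b ^ 2) * |y| = w at *
  have p1 := div_nonneg (sub_nonneg.mpr (Real.arctan_lt_pi_div_two ((a * δ + b * y) / w)).le) hw.le
  have p2 := div_nonneg
    (sub_nonneg.mpr (Real.arctan_lt_pi_div_two ((a * δ + -(b * y)) / w)).le) hw.le
  have key (p q : ℝ) : p / w - -q / w - π / w = -((π / 2 - p) / w + (π / 2 - q) / w) := by ring
  rw [key, abs_neg, abs_of_nonneg (add_nonneg p1 p2)]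
  linarith
end

section
/- Let α be irrational, β ∈ T, n ≥ 1, and define J_n^β : T → T by J_n^β(x) = β − (n−1)α − x. For any x ∈ T such that x + iα ≠ 0 and x − β + iα ≠ 0 for all 0 ≤ i < n, one has Θ_n^β(J_n^β(x)) = 1/Θ_n^β(x). -/
/-- A sum of inverse norms along a finite orbit segment of a translation is invariant under the
reflection exchanging the two ends of the segment. -/
theorem sum_inv_norm_add_nsmul_reflect {E : Type*} [SeminormedAddCommGroup E] (a y : E) (n : ℕ) :
    ∑ i ∈ Finset.range n, ‖-y - (n - 1) • a + i • a‖⁻¹ =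
      ∑ i ∈ Finset.range n, ‖y + i • a‖⁻¹ := by
  rw [← Finset.sum_range_reflect (fun i => ‖y + i • a‖⁻¹)]
  refine Finset.sum_congr rfl fun i hi => ?_
  have hle : i ≤ n - 1 := Nat.le_sub_one_of_lt (Finset.mem_range.mp hi)
  rw [← norm_neg, sub_nsmul a hle]
  congr 2
  abel


/-- On the circle `T = ℝ/ℤ`, for irrational `α`, `β ∈ T` and
`n ≥ 1`, consider `Sₙ(y) = Σ_{i<n} ‖y + iα‖⁻¹`, `Θₙᵝ(y) = Sₙ(y)/Sₙ(y−β)` and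
`Jₙᵝ(y) = β − (n−1)α − y`.  If `x + iα ≠ 0` and `x − β + iα ≠ 0` for all
`0 ≤ i < n`, then `Θₙᵝ(Jₙᵝ(x)) = 1/Θₙᵝ(x)`. -/
theorem stmt_2 (α : ℝ) (hα : Irrational α) (β : UnitAddCircle) (n : ℕ) (hn : 1 ≤ n)
    (x : UnitAddCircle)
    (hx : ∀ i < n, x + i • (α : UnitAddCircle) ≠ 0)
    (hxβ : ∀ i < n, x - β + i • (α : UnitAddCircle) ≠ 0) :
    (∑ i ∈ Finset.range n,
        ‖(β - (n - 1) • (α : UnitAddCircle) - x) + i • (α : UnitAddCircle)‖⁻¹) /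
      (∑ i ∈ Finset.range n,
        ‖(β - (n - 1) • (α : UnitAddCircle) - x) - β + i • (α : UnitAddCircle)‖⁻¹) =
    ((∑ i ∈ Finset.range n, ‖x + i • (α : UnitAddCircle)‖⁻¹) /
      (∑ i ∈ Finset.range n, ‖x - β + i • (α : UnitAddCircle)‖⁻¹))⁻¹ := by
  rw [inv_div, ← sum_inv_norm_add_nsmul_reflect _ x n,
    ← sum_inv_norm_add_nsmul_reflect _ (x - β) n]
  congr! 5 <;> abel
end

section
/- Let α be irrational and n ≥ 1. Let y ∈ T be such that y + iα ≠ 0 for all 0 ≤ i < q_n, set S(y) = Σ_{i=0}^{q_n−1} 1/‖y + iα‖, and let y₀ be a point of the finite orbit {y + iα : 0 ≤ i < q_n} with minimal value of ‖·‖. Then 1/‖y₀‖ + log(q_n)/(2 λ^{(n−1)}) ≤ S(y) ≤ 1/‖y₀‖ + 4 log(q_n)/λ^{(n−1)}. -/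
/-- The complete quotients of the continued fraction expansion of `α`
(`cfQuot α 0 = α`, and `cfQuot α (n+1)` is the inverse of the fractional part
of `cfQuot α n`). -/
noncomputable def cfQuot (α : ℝ) : ℕ → ℝ
  | 0 => α
  | n + 1 => (cfQuot α n - ⌊cfQuot α n⌋)⁻¹

/-- The partial quotients `aₙ` of the continued fraction expansion
`α = [a₀; a₁, a₂, …]` (as natural numbers; for irrational `α` and `n ≥ 1`
one has `cfa α n ≥ 1`). -/
noncomputable def cfa (α : ℝ) (n : ℕ) : ℕ := (⌊cfQuot α n⌋).toNat

/-- The denominators `qₙ` of the convergents `pₙ/qₙ` of `α`: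
`q₀ = 1`, `q₁ = a₁` and `q_{n+2} = a_{n+2} q_{n+1} + q_n`. -/
noncomputable def cfq (α : ℝ) : ℕ → ℕ
  | 0 => 1
  | 1 => cfa α 1
  | n + 2 => cfa α (n + 2) * cfq α (n + 1) + cfq α n

/-- The numerators `pₙ` of the convergents `pₙ/qₙ` of `α`:
`p₀ = a₀`, `p₁ = a₁ a₀ + 1` and `p_{n+2} = a_{n+2} p_{n+1} + pₙ`. -/
noncomputable def cfp (α : ℝ) : ℕ → ℤ
  | 0 => ⌊α⌋
  | 1 => (cfa α 1 : ℤ) * ⌊α⌋ + 1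
  | n + 2 => (cfa α (n + 2) : ℤ) * cfp α (n + 1) + cfp α n

/-- `ρₙ = qₙ α − pₙ`. -/
noncomputable def cfrho (α : ℝ) (n : ℕ) : ℝ := (cfq α n : ℝ) * α - (cfp α n : ℝ)

/-- `λ⁽ⁿ⁾ = |ρₙ| = ‖qₙ α‖`, the distance from `qₙ α` to the nearest integer. -/
noncomputable def cflam (α : ℝ) (n : ℕ) : ℝ := |cfrho α n|

/-! ### Continued fraction recursions -/

theorem irrational_cfQuot {α : ℝ} (hα : Irrational α) (n : ℕ) : Irrational (cfQuot α n) := by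
  induction n with
  | zero => exact hα
  | succ n ih => exact irrational_inv_iff.2 (ih.sub_intCast _)

theorem fract_cfQuot_pos {α : ℝ} (hα : Irrational α) (n : ℕ) : 0 < Int.fract (cfQuot α n) :=
  lt_of_le_of_ne (Int.fract_nonneg _)
    (((irrational_cfQuot hα n).sub_intCast ⌊cfQuot α n⌋).ne_zero).symm

theorem cfQuot_succ (α : ℝ) (n : ℕ) : cfQuot α (n + 1) = (Int.fract (cfQuot α n))⁻¹ := rfl

theorem one_le_floor_cfQuot_succ {α : ℝ} (hα : Irrational α) (n : ℕ) :
    1 ≤ ⌊cfQuot α (n + 1)⌋ := by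
  rw [Int.le_floor, cfQuot_succ, Int.cast_one]
  exact (one_le_inv₀ (fract_cfQuot_pos hα n)).2 (Int.fract_lt_one _).le

theorem cfa_succ_cast {α : ℝ} (hα : Irrational α) (n : ℕ) :
    (cfa α (n + 1) : ℝ) = cfQuot α (n + 1) - Int.fract (cfQuot α (n + 1)) := by
  have h : ((cfa α (n + 1) : ℕ) : ℤ) = ⌊cfQuot α (n + 1)⌋ :=
    Int.toNat_of_nonneg (by linarith [one_le_floor_cfQuot_succ hα n])
  rw [Int.self_sub_fract, ← h, Int.cast_natCast]

theorem one_le_cfa_succ {α : ℝ} (hα : Irrational α) (n : ℕ) : 1 ≤ cfa α (n + 1) := by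
  have := one_le_floor_cfQuot_succ hα n
  unfold cfa
  omega

theorem cfq_pos {α : ℝ} (hα : Irrational α) : ∀ n, 0 < cfq α n
  | 0 => Nat.one_pos
  | 1 => one_le_cfa_succ hα 0
  | n + 2 => Nat.add_pos_right _ (cfq_pos hα n)

theorem cfq_le_succ {α : ℝ} (hα : Irrational α) : ∀ n, cfq α n ≤ cfq α (n + 1)
  | 0 => one_le_cfa_succ hα 0
  | n + 1 => (Nat.le_mul_of_pos_left _ (one_le_cfa_succ hα (n + 1))).trans (Nat.le_add_right _ _)

theorem cfp_mul_cfq_sub (α : ℝ) (n : ℕ) :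
    cfp α (n + 1) * cfq α n - cfp α n * cfq α (n + 1) = (-1) ^ n := by
  induction n with
  | zero => simp [cfp, cfq]; ring
  | succ n ih =>
    rw [pow_succ, ← ih]
    simp only [cfp, cfq]
    push_cast
    ring

theorem cfrho_succ {α : ℝ} (hα : Irrational α) (n : ℕ) :
    cfrho α (n + 1) = -(cfrho α n * Int.fract (cfQuot α (n + 1))) := by
  induction n with
  | zero =>
    have h0 := (fract_cfQuot_pos hα 0).ne'
    have h1 := cfa_succ_cast hα 0
    have h2 := cfQuot_succ α 0
    have h3 : cfrho α 0 = Int.fract (cfQuot α 0) := by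
      simp [cfrho, cfq, cfp, cfQuot]
    have h4 : cfrho α 1 = cfa α 1 * cfrho α 0 - 1 := by
      simp only [cfrho, cfq, cfp]
      push_cast
      ring
    have h5 : cfQuot α 1 * Int.fract (cfQuot α 0) = 1 := by
      rw [h2]
      exact inv_mul_cancel₀ h0
    simp only [zero_add] at h1 ⊢
    rw [h4, h3, h1]
    linear_combination h5
  | succ n ih =>
    have h0 := (fract_cfQuot_pos hα (n + 1)).ne'
    have h1 := cfa_succ_cast hα (n + 1)
    have h4 : cfrho α (n + 2) = cfa α (n + 2) * cfrho α (n + 1) + cfrho α n := by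
      simp only [cfrho, cfq, cfp]
      push_cast
      ring
    have h5 : cfQuot α (n + 2) * Int.fract (cfQuot α (n + 1)) = 1 := by
      rw [cfQuot_succ α (n + 1)]
      exact inv_mul_cancel₀ h0
    rw [h4, h1]
    linear_combination cfQuot α (n + 2) * ih - cfrho α n * h5

theorem cfrho_ne_zero {α : ℝ} (hα : Irrational α) (n : ℕ) : cfrho α n ≠ 0 :=
  ((hα.natCast_mul (cfq_pos hα n).ne').sub_intCast _).ne_zero

theorem cflam_pos {α : ℝ} (hα : Irrational α) (n : ℕ) : 0 < cflam α n :=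
  abs_pos.2 (cfrho_ne_zero hα n)

theorem cfrho_mul_cfrho_succ_nonpos {α : ℝ} (hα : Irrational α) (n : ℕ) :
    cfrho α n * cfrho α (n + 1) ≤ 0 := by
  rw [cfrho_succ hα]
  nlinarith [mul_nonneg (mul_self_nonneg (cfrho α n)) (Int.fract_nonneg (cfQuot α (n + 1)))]

theorem cflam_succ_le {α : ℝ} (hα : Irrational α) (n : ℕ) : cflam α (n + 1) ≤ cflam α n := by
  unfold cflam
  rw [cfrho_succ hα, abs_neg, abs_mul, abs_of_pos (fract_cfQuot_pos hα (n + 1))]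
  exact mul_le_of_le_one_right (abs_nonneg _) (Int.fract_lt_one _).le

/-- Two reals of opposite weak signs do not cancel in a difference. -/
theorem abs_sub_of_mul_nonpos {a b : ℝ} (h : a * b ≤ 0) : |a - b| = |a| + |b| := by
  rcases mul_nonpos_iff.1 h with ⟨ha, hb⟩ | ⟨ha, hb⟩
  · rw [abs_of_nonneg ha, abs_of_nonpos hb, abs_of_nonneg (by linarith)]; ring
  · rw [abs_of_nonpos ha, abs_of_nonneg hb, abs_of_nonpos (by linarith)]; ring

theorem cfq_succ_mul_cflam_add {α : ℝ} (hα : Irrational α) (n : ℕ) :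
    cfq α (n + 1) * cflam α n + cfq α n * cflam α (n + 1) = 1 := by
  have hdet : (cfp α (n + 1) : ℝ) * cfq α n - cfp α n * cfq α (n + 1) = (-1) ^ n := by
    exact_mod_cast cfp_mul_cfq_sub α n
  have h1 : cfq α (n + 1) * cfrho α n - cfq α n * cfrho α (n + 1) = (-1) ^ n := by
    rw [← hdet]; unfold cfrho; ring
  have h2 : (cfq α (n + 1) * cfrho α n) * (cfq α n * cfrho α (n + 1)) ≤ 0 := by
    have := mul_nonneg (Nat.cast_nonneg (α := ℝ) (cfq α (n + 1))) (Nat.cast_nonneg (cfq α n))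
    nlinarith [mul_nonneg this (neg_nonneg.2 (cfrho_mul_cfrho_succ_nonpos hα n))]
  have h3 := abs_sub_of_mul_nonpos h2
  rw [h1, abs_pow, abs_neg, abs_one, one_pow, abs_mul, abs_mul, Nat.abs_cast, Nat.abs_cast] at h3
  exact h3.symm

theorem half_le_cfq_succ_mul_cflam {α : ℝ} (hα : Irrational α) (n : ℕ) :
    1 / 2 ≤ cfq α (n + 1) * cflam α n := by
  have h1 := cfq_succ_mul_cflam_add hα n
  have h2 : (cfq α n : ℝ) * cflam α (n + 1) ≤ cfq α (n + 1) * cflam α n :=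
    mul_le_mul (by exact_mod_cast cfq_le_succ hα n) (cflam_succ_le hα n)
      (cflam_pos hα _).le (Nat.cast_nonneg _)
  linarith

/-- Convergents are best approximations. -/
theorem cflam_le_abs_mul_sub {α : ℝ} (hα : Irrational α) (n : ℕ) {k : ℤ} (hk : k ≠ 0)
    (hkq : |k| < cfq α (n + 1)) (l : ℤ) : cflam α n ≤ |k * α - l| := by
  set D : ℤ := (-1) ^ n
  have hD : D * D = 1 := by
    rw [← mul_pow]; simp
  have hdet := cfp_mul_cfq_sub α n
  set a : ℤ := D * (l * cfq α n - k * cfp α n) with ha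
  set b : ℤ := D * (cfp α (n + 1) * k - cfq α (n + 1) * l) with hb
  have hk' : k = a * cfq α (n + 1) + b * cfq α n := by
    rw [ha, hb]; linear_combination (-k) * hD - D * k * hdet
  have hl' : l = a * cfp α (n + 1) + b * cfp α n := by
    rw [ha, hb]; linear_combination (-l) * hD - D * l * hdet
  have hq := cfq_pos hα (n + 1)
  have hq' := cfq_pos hα n
  clear_value a b
  have hb0 : b ≠ 0 := by
    rintro rfl
    have ha0 : a ≠ 0 := by rintro rfl; simp at hk'; exact hk hk'
    rw [hk', zero_mul, add_zero, abs_mul, Nat.abs_cast] at hkq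
    have := Int.one_le_abs ha0
    nlinarith
  have hab : a * b ≤ 0 := by
    by_contra! h
    rcases pos_and_pos_or_neg_and_neg_of_mul_pos h with ⟨h1, h2⟩ | ⟨h1, h2⟩
    · have := (le_abs_self k).trans_lt hkq
      nlinarith
    · have := (neg_le_abs k).trans_lt hkq
      nlinarith
  have hsum : (k : ℝ) * α - l = b * cfrho α n - (-(a * cfrho α (n + 1))) := by
    rw [hk', hl']; push_cast; unfold cfrho; ring
  have hab' : ((a : ℝ) * b) ≤ 0 := by exact_mod_cast hab
  rw [hsum, abs_sub_of_mul_nonpos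
    (by nlinarith [mul_nonneg_of_nonpos_of_nonpos hab' (cfrho_mul_cfrho_succ_nonpos hα n)]), abs_mul]
  have : (1 : ℝ) ≤ |(b : ℝ)| := by exact_mod_cast Int.one_le_abs hb0
  have h3 := abs_nonneg (-((a : ℝ) * cfrho α (n + 1)))
  have h4 := le_mul_of_one_le_left (abs_nonneg (cfrho α n)) this
  unfold cflam
  linarith

/-! ### Upper bound for sums of reciprocals of separated points -/

theorem inv_le_log_ratio (m : ℕ) :
    1 / ((m : ℝ) + 1 / 2) ≤ 2 * Real.log (2 * (m + 1) + 1) - 2 * Real.log (2 * m + 1) := by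
  have hm : (0 : ℝ) ≤ m := Nat.cast_nonneg m
  have h := Real.le_log_one_add_of_nonneg (x := 2 / (2 * (m : ℝ) + 1)) (by positivity)
  have h1 : 1 + 2 / (2 * (m : ℝ) + 1) = (2 * (m + 1) + 1) / (2 * m + 1) := by field_simp; ring
  have h2 : 2 * (2 / (2 * (m : ℝ) + 1)) / (2 / (2 * (m : ℝ) + 1) + 2) = 1 / (m + 1) := by
    field_simp; ring
  rw [h1, h2, Real.log_div (by positivity) (by positivity)] at h
  have h3 : 1 / ((m : ℝ) + 1 / 2) ≤ 2 * (1 / (m + 1)) := by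
    rw [mul_one_div, div_le_div_iff₀ (by positivity) (by positivity)]
    linarith
  linarith

theorem sum_inv_le_of_separated {ι : Type*} (x : ι → ℝ) {lam : ℝ} (hlam : 0 < lam)
    (S : Finset ι) (hsep : ∀ i ∈ S, ∀ j ∈ S, i ≠ j → lam ≤ |x i - x j|)
    (hx : ∀ i ∈ S, lam / 2 ≤ x i) :
    (∑ i ∈ S, (x i)⁻¹ ≤ 2 * Real.log (2 * S.card + 1) / lam) ∧
      ∀ M, lam / 2 ≤ M → (∀ i ∈ S, x i + lam ≤ M) → (S.card + 1 / 2) * lam ≤ M := by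
  classical
  induction S using Finset.induction_on_max_value x with
  | empty =>
    refine ⟨by simp, fun M hM _ => ?_⟩
    simp only [Finset.card_empty, Nat.cast_zero]
    linarith
  | insert a S haS hmax ih =>
    obtain ⟨ih1, ih2⟩ := ih
      (fun i hi j hj => hsep i (Finset.mem_insert_of_mem hi) j (Finset.mem_insert_of_mem hj))
      (fun i hi => hx i (Finset.mem_insert_of_mem hi))
    have ha : ((S.card : ℝ) + 1 / 2) * lam ≤ x a := by
      refine ih2 _ (hx a (Finset.mem_insert_self _ _)) fun i hi => ?_
      have h1 := hsep a (Finset.mem_insert_self _ _) i (Finset.mem_insert_of_mem hi)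
        (fun h => haS (h ▸ hi))
      rw [abs_of_nonneg (by linarith [hmax i hi])] at h1
      linarith
    rw [Finset.sum_insert haS, Finset.card_insert_of_notMem haS]
    push_cast
    refine ⟨?_, fun M _ hM => ?_⟩
    · have h1 : (x a)⁻¹ ≤ 1 / ((S.card : ℝ) + 1 / 2) / lam := by
        rw [div_div, one_div]
        exact inv_anti₀ (by positivity) ha
      have h2 := div_le_div_of_nonneg_right (inv_le_log_ratio S.card) hlam.le
      rw [sub_div] at h2
      linarith
    · have := hM a (Finset.mem_insert_self _ _)
      linarith

theorem sum_inv_abs_le_of_separated {ι : Type*} [DecidableEq ι] (x : ι → ℝ) {lam : ℝ}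
    (hlam : 0 < lam) (S : Finset ι) {j₀ : ι} (hj₀ : j₀ ∈ S)
    (hsep : ∀ i ∈ S, ∀ j ∈ S, i ≠ j → lam ≤ |x i - x j|)
    (hmin : ∀ i ∈ S, |x j₀| ≤ |x i|) :
    ∑ i ∈ S, |x i|⁻¹ ≤ |x j₀|⁻¹ + 4 * Real.log S.card / lam := by
  have hhalf : ∀ i ∈ S.erase j₀, lam / 2 ≤ |x i| := fun i hi => by
    have hi' := Finset.mem_erase.1 hi
    have h1 := hsep i hi'.2 j₀ hj₀ hi'.1
    have h2 := abs_sub (x i) (x j₀)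
    have h3 := hmin i hi'.2
    linarith
  set P := (S.erase j₀).filter (fun i => 0 ≤ x i)
  set N := (S.erase j₀).filter (fun i => ¬ 0 ≤ x i)
  have hP := (sum_inv_le_of_separated x hlam P
    (fun i hi j hj => hsep i (Finset.mem_of_mem_erase (Finset.mem_filter.1 hi).1)
      j (Finset.mem_of_mem_erase (Finset.mem_filter.1 hj).1))
    (fun i hi => by
      have h := Finset.mem_filter.1 hi
      exact (hhalf i h.1).trans_eq (abs_of_nonneg h.2))).1
  have hN := (sum_inv_le_of_separated (fun i => -x i) hlam N
    (fun i hi j hj hij => by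
      have := hsep j (Finset.mem_of_mem_erase (Finset.mem_filter.1 hj).1)
        i (Finset.mem_of_mem_erase (Finset.mem_filter.1 hi).1) hij.symm
      rwa [neg_sub_neg])
    (fun i hi => by
      have h := Finset.mem_filter.1 hi
      exact (hhalf i h.1).trans_eq (abs_of_neg (not_le.1 h.2)))).1
  have hP' : ∑ i ∈ P, |x i|⁻¹ = ∑ i ∈ P, (x i)⁻¹ :=
    Finset.sum_congr rfl fun i hi => by rw [abs_of_nonneg (Finset.mem_filter.1 hi).2]
  have hN' : ∑ i ∈ N, |x i|⁻¹ = ∑ i ∈ N, (-x i)⁻¹ :=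
    Finset.sum_congr rfl fun i hi => by rw [abs_of_neg (not_le.1 (Finset.mem_filter.1 hi).2)]
  have hcard : P.card + N.card + 1 = S.card := by
    rw [Finset.card_filter_add_card_filter_not, Finset.card_erase_add_one hj₀]
  have hlog : 2 * Real.log (2 * P.card + 1) + 2 * Real.log (2 * N.card + 1) ≤
      4 * Real.log S.card := by
    rw [← mul_add, ← Real.log_mul (by positivity) (by positivity), ← hcard]
    have h : Real.log ((2 * (P.card : ℝ) + 1) * (2 * N.card + 1)) ≤
        Real.log (((P.card : ℝ) + N.card + 1) ^ 2) :=
      Real.log_le_log (by positivity) (by nlinarith [sq_nonneg ((P.card : ℝ) - N.card)])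
    rw [Real.log_pow] at h
    push_cast at h ⊢
    linarith
  rw [← Finset.add_sum_erase _ _ hj₀,
    ← Finset.sum_filter_add_sum_filter_not (S.erase j₀) (fun i => 0 ≤ x i), hP', hN']
  have := div_le_div_of_nonneg_right hlog hlam.le
  rw [add_div] at this
  linarith

/-! ### Lower bound for orbits close to a regular grid -/

/-- The enumeration `0, -1, 1, -2, 2, …` of the integers. -/
def zigzag (j : ℕ) : ℤ := if j % 2 = 0 then (j / 2 : ℕ) else -((j + 1) / 2 : ℕ)

theorem abs_zigzag_sub_lt {q i j : ℕ} (hi : i < q) (hj : j < q) :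
    |zigzag i - zigzag j| < q := by
  rw [abs_lt]
  unfold zigzag
  split_ifs <;> constructor <;> omega

theorem zigzag_injective : Function.Injective zigzag := by
  intro i j h
  unfold zigzag at h
  split_ifs at h <;> omega

theorem abs_add_zigzag_le {s : ℝ} (h0 : 0 ≤ s) (h1 : s ≤ 1 / 2) (j : ℕ) :
    |s + zigzag j| ≤ (j + 1) / 2 := by
  unfold zigzag
  split_ifs with h
  · have : (j : ℝ) = 2 * ((j / 2 : ℕ) : ℝ) := by
      have : j = 2 * (j / 2) := by omega
      exact_mod_cast this
    rw [Int.cast_natCast, abs_le]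
    constructor <;> linarith [Nat.cast_nonneg (α := ℝ) (j / 2)]
  · have h2 : (j : ℝ) + 1 = 2 * (((j + 1) / 2 : ℕ) : ℝ) := by
      have : j + 1 = 2 * ((j + 1) / 2) := by omega
      exact_mod_cast this
    have h3 : (1 : ℝ) ≤ (((j + 1) / 2 : ℕ) : ℝ) := by
      have : 1 ≤ (j + 1) / 2 := by omega
      exact_mod_cast this
    rw [Int.cast_neg, Int.cast_natCast, abs_le]
    constructor <;> linarith

/-- The integer translates of a real number can be enumerated by absolute value. -/
theorem exists_enumeration_abs_add_le (c : ℝ) : ∃ k : ℕ → ℤ, Function.Injective k ∧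
    (∀ q i j : ℕ, i < q → j < q → |k i - k j| < q) ∧ ∀ j : ℕ, |c + k j| ≤ (j + 1) / 2 := by
  have hr := abs_sub_round c
  rcases le_total 0 (c - round c) with h | h
  · refine ⟨fun j => zigzag j - round c, fun i j hij => zigzag_injective (by simpa using hij),
      fun q i j hi hj => by simpa using abs_zigzag_sub_lt hi hj, fun j => ?_⟩
    have := abs_add_zigzag_le h ((le_abs_self _).trans hr) j
    convert this using 2
    push_cast; ring
  · refine ⟨fun j => -zigzag j - round c, fun i j hij => zigzag_injective (by simpa using hij),
      fun q i j hi hj => ?_, fun j => ?_⟩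
    · have := abs_zigzag_sub_lt hj hi
      convert this using 2
      ring
    · have := abs_add_zigzag_le (neg_nonneg.2 h) ((neg_le_abs _).trans hr) j
      rw [← abs_neg]
      convert this using 2
      push_cast; ring

/-- The points `Y + iα`, `i < q`, lie close to a translate of the grid `q⁻¹ℤ`, if `α` is close
to the reduced fraction `p / q`. -/
theorem exists_enumeration_norm_le (α Y : ℝ) {q : ℕ} (hq : 0 < q) {p : ℤ}
    (hpq : IsCoprime p (q : ℤ)) :
    ∃ e : ℕ → ℕ, Set.BijOn e (Finset.range q) (Finset.range q) ∧
      ∀ j ∈ Finset.range q, ‖(Y : UnitAddCircle) + e j • (α : UnitAddCircle)‖ ≤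
        (j + 1 + q * |q * α - p|) / (2 * q) := by
  have hq' : (0 : ℝ) < q := by exact_mod_cast hq
  have hqz : (0 : ℤ) < q := by exact_mod_cast hq
  set ρ : ℝ := q * α - p
  obtain ⟨k, hkinj, hkdiff, hk⟩ := exists_enumeration_abs_add_le (q * (Y + ρ / 2))
  obtain ⟨a, b, hab⟩ := hpq
  refine ⟨fun j => (a * k j % q).toNat, ?_, ?_⟩
  · have hmaps : Set.MapsTo (fun j => (a * k j % q).toNat) (Finset.range q) (Finset.range q) := by
      intro j _
      have h1 := Int.emod_nonneg (a * k j) hqz.ne'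
      have h2 := Int.emod_lt_of_pos (a * k j) hqz
      simp only [Finset.coe_range, Set.mem_Iio]
      omega
    have hinj : Set.InjOn (fun j => (a * k j % q).toNat) (Finset.range q) := by
      intro i hi j hj hij
      have h1 := Int.emod_nonneg (a * k i) hqz.ne'
      have h2 := Int.emod_nonneg (a * k j) hqz.ne'
      have h3 : a * k i % q = a * k j % q := by simp only at hij; omega
      have h4 : (q : ℤ) ∣ a * k i - a * k j :=
        Int.ModEq.dvd (show a * k j ≡ a * k i [ZMOD q] from h3.symm)
      rw [← mul_sub] at h4
      have h5 : IsCoprime (q : ℤ) a := ⟨b, p, by linarith⟩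
      have h6 := Int.eq_zero_of_abs_lt_dvd (h5.dvd_of_dvd_mul_left h4)
        (hkdiff q i j (by simpa using hi) (by simpa using hj))
      exact hkinj (by linarith)
    exact ⟨hmaps, hinj, Finset.surjOn_of_injOn_of_card_le _ hmaps hinj le_rfl⟩
  · intro j _
    have h1 := Int.emod_nonneg (a * k j) hqz.ne'
    have h2 := Int.emod_lt_of_pos (a * k j) hqz
    have h3 := Int.emod_add_mul_ediv (a * k j) q
    set r : ℕ := (a * k j % q).toNat with hr
    have hr1 : (r : ℤ) = a * k j % q := Int.toNat_of_nonneg h1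
    have hr2 : (r : ℝ) ≤ q := by
      have : r < q := by omega
      exact_mod_cast this.le
    set m : ℤ := -(b * k j) - p * (a * k j / q) with hm
    have hrp : (r : ℤ) * p = k j + q * m := by
      rw [hr1, hm]; linear_combination p * h3 + k j * hab
    have hrp' : (r : ℝ) * p = k j + q * m := by exact_mod_cast hrp
    have hcoe : (Y : UnitAddCircle) + r • (α : UnitAddCircle) =
        ((Y + r * α - m : ℝ) : UnitAddCircle) := by
      have : ((m : ℝ) : UnitAddCircle) = 0 := by
        rw [AddCircle.coe_eq_zero_iff]
        exact ⟨m, by simp⟩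
      rw [AddCircle.coe_sub, AddCircle.coe_add, this, sub_zero, ← nsmul_eq_mul, AddCircle.coe_nsmul]
    have hnorm : ‖((Y + r * α - m : ℝ) : UnitAddCircle)‖ ≤ |Y + r * α - m| := by
      rw [← Real.norm_eq_abs]
      exact QuotientAddGroup.norm_mk_le_norm
    change ‖(Y : UnitAddCircle) + r • (α : UnitAddCircle)‖ ≤ _
    rw [hcoe]
    refine hnorm.trans ?_
    have hdecomp : q * (Y + r * α - m) = (q * (Y + ρ / 2) + k j) + (r - q / 2) * ρ := by
      simp only [ρ]; linear_combination hrp'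
    have habs : |((r : ℝ) - q / 2) * ρ| ≤ q / 2 * |ρ| := by
      rw [abs_mul]
      refine mul_le_mul_of_nonneg_right ?_ (abs_nonneg _)
      rw [abs_le]
      constructor <;> linarith [Nat.cast_nonneg (α := ℝ) r]
    have h5 : q * |Y + r * α - m| ≤ (j + 1) / 2 + q / 2 * |ρ| := by
      rw [← abs_of_pos hq', ← abs_mul, abs_of_pos hq', hdecomp]
      exact (abs_add_le _ _).trans (add_le_add (hk j) habs)
    rw [le_div_iff₀ (by positivity)]
    linarith

theorem log_le_sum_two_div (q : ℕ) (hq : 1 ≤ q) :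
    Real.log q ≤ ∑ j ∈ Finset.Ico 1 q, 2 / ((j : ℝ) + 3 / 2) := by
  induction q, hq using Nat.le_induction with
  | base => simp
  | succ q hq ih =>
    rw [Finset.sum_Ico_succ_top hq]
    have hq' : (0 : ℝ) < q := by exact_mod_cast hq
    have h1 : Real.log ((q + 1 : ℕ) : ℝ) = Real.log q + Real.log (1 + 1 / q) := by
      rw [← Real.log_mul (by positivity) (by positivity)]
      congr 1
      push_cast
      field_simp
    have h2 : Real.log (1 + 1 / q) ≤ 2 / ((q : ℝ) + 3 / 2) := by
      rcases hq.eq_or_lt with rfl | hq2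
      · have := Real.log_two_lt_d9
        norm_num at this ⊢
        linarith
      · have hq2' : (2 : ℝ) ≤ q := by exact_mod_cast hq2
        have := Real.log_le_sub_one_of_pos (x := 1 + 1 / (q : ℝ)) (by positivity)
        refine this.trans ?_
        rw [add_sub_cancel_left, div_le_div_iff₀ (by positivity) (by positivity)]
        linarith
    linarith

theorem inv_add_log_le_sum_inv {q : ℕ} {lam mu : ℝ} (hmu : mu ≤ lam) (hmu0 : 0 ≤ mu)
    (hlam : 1 / 2 ≤ q * lam) (f : ℕ → ℝ) (hf : ∀ i < q, 0 < f i)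
    {e : ℕ → ℕ} (he : Set.BijOn e (Finset.range q) (Finset.range q))
    (hfe : ∀ j ∈ Finset.range q, f (e j) ≤ (j + 1 + q * mu) / (2 * q))
    {j₀ : ℕ} (hj₀ : j₀ < q) :
    (f j₀)⁻¹ + Real.log q / (2 * lam) ≤ ∑ i ∈ Finset.range q, (f i)⁻¹ := by
  have hq : 0 < q := by omega
  have hq' : (0 : ℝ) < q := by exact_mod_cast hq
  have hlam0 : 0 < lam := by
    by_contra! h
    nlinarith
  obtain ⟨t, ht, rfl⟩ := he.surjOn (by simpa using hj₀ : j₀ ∈ (Finset.range q : Set ℕ))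
  have ht' : t ∈ Finset.range q := ht
  have hreindex : ∑ i ∈ Finset.range q, (f i)⁻¹ = ∑ j ∈ Finset.range q, (f (e j))⁻¹ :=
    (Finset.sum_nbij e (fun j hj => he.mapsTo hj) he.injOn he.surjOn fun _ _ => rfl).symm
  set T : ℕ → ℝ := fun j => 2 * q / (j + 1 + q * mu) with hT
  have hTle : ∀ j ∈ Finset.range q, T j ≤ (f (e j))⁻¹ := fun j hj => by
    have h1 := hf (e j) (by simpa using he.mapsTo hj)
    have := inv_anti₀ h1 (hfe j hj)
    rwa [inv_div] at this
  have hT0 : T t ≤ T 0 := by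
    simp only [hT]
    refine div_le_div_of_nonneg_left (by positivity) (by positivity) ?_
    have := Nat.cast_nonneg (α := ℝ) t
    push_cast
    linarith
  have h1 : ∑ j ∈ (Finset.range q).erase t, T j ≤ ∑ j ∈ (Finset.range q).erase t, (f (e j))⁻¹ :=
    Finset.sum_le_sum fun j hj => hTle j (Finset.mem_of_mem_erase hj)
  have h2 := Finset.add_sum_erase (Finset.range q) T ht'
  have h3 := Finset.add_sum_erase (Finset.range q) (fun j => (f (e j))⁻¹) ht'
  have h4 : ∑ j ∈ Finset.range q, T j = T 0 + ∑ j ∈ Finset.Ico 1 q, T j := by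
    rw [Finset.range_eq_Ico, Finset.sum_eq_sum_Ico_succ_bot hq]
  have h5 : Real.log q / (2 * lam) ≤ ∑ j ∈ Finset.Ico 1 q, T j := by
    rw [div_le_iff₀ (by positivity), Finset.sum_mul]
    refine (log_le_sum_two_div q hq).trans (Finset.sum_le_sum fun j _ => ?_)
    simp only [hT]
    have hj := Nat.cast_nonneg (α := ℝ) j
    have : (0 : ℝ) ≤ q * mu := by positivity
    rw [div_mul_eq_mul_div, div_le_div_iff₀ (by positivity) (by positivity)]
    have h6 : (q : ℝ) * mu ≤ q * lam := mul_le_mul_of_nonneg_left hmu hq'.le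
    nlinarith [mul_nonneg hj (sub_nonneg.2 hlam)]
  rw [hreindex, ← h3]
  linarith

/-- Let `α` be irrational and `n ≥ 1`.  Let `y ∈ T` be such
that `y + iα ≠ 0` for all `0 ≤ i < qₙ`, let `S(y) = Σ_{i<qₙ} ‖y + iα‖⁻¹`, and
let `y₀ = y + j₀α` be a point of the orbit `{y + iα : 0 ≤ i < qₙ}` of minimal
norm.  Then `‖y₀‖⁻¹ + log qₙ/(2 λ⁽ⁿ⁻¹⁾) ≤ S(y) ≤ ‖y₀‖⁻¹ + 4 log qₙ/λ⁽ⁿ⁻¹⁾`. -/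
theorem stmt_3 (α : ℝ) (hα : Irrational α) (n : ℕ) (hn : 1 ≤ n)
    (y : UnitAddCircle) (hy : ∀ i < cfq α n, y + i • (α : UnitAddCircle) ≠ 0)
    (j₀ : ℕ) (hj₀ : j₀ < cfq α n)
    (hmin : ∀ i < cfq α n, ‖y + j₀ • (α : UnitAddCircle)‖ ≤ ‖y + i • (α : UnitAddCircle)‖) :
    ‖y + j₀ • (α : UnitAddCircle)‖⁻¹ + Real.log (cfq α n) / (2 * cflam α (n - 1)) ≤
        (∑ i ∈ Finset.range (cfq α n), ‖y + i • (α : UnitAddCircle)‖⁻¹) ∧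
      (∑ i ∈ Finset.range (cfq α n), ‖y + i • (α : UnitAddCircle)‖⁻¹) ≤
        ‖y + j₀ • (α : UnitAddCircle)‖⁻¹ + 4 * Real.log (cfq α n) / cflam α (n - 1) := by
  obtain ⟨m, rfl⟩ : ∃ m, n = m + 1 := ⟨n - 1, by omega⟩
  obtain ⟨Y, rfl⟩ := QuotientAddGroup.mk_surjective y
  rw [Nat.add_sub_cancel]
  change ∀ i < _, (Y : UnitAddCircle) + _ ≠ 0 at hy
  have hq := cfq_pos hα (m + 1)
  constructor
  · have hcop : IsCoprime (cfp α (m + 1)) (cfq α (m + 1) : ℤ) := by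
      have hdet := cfp_mul_cfq_sub α m
      have hD : ((-1 : ℤ) ^ m) * (-1) ^ m = 1 := by rw [← mul_pow]; simp
      exact ⟨(-1) ^ m * cfq α m, -((-1) ^ m * cfp α m), by
        linear_combination (-1) ^ m * hdet + hD⟩
    obtain ⟨e, he, hnorm⟩ := exists_enumeration_norm_le α Y hq hcop
    exact inv_add_log_le_sum_inv (cflam_succ_le hα m) (cflam_pos hα _).le
      (half_le_cfq_succ_mul_cflam hα m)
      (fun i => ‖(Y : UnitAddCircle) + i • (α : UnitAddCircle)‖)
      (fun i hi => norm_pos_iff.2 (hy i hi)) he hnorm hj₀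
  · set x : ℕ → ℝ := fun i => Y + i * α - round (Y + i * α) with hx
    have hnorm : ∀ i : ℕ, ‖(Y : UnitAddCircle) + i • (α : UnitAddCircle)‖ = |x i| := fun i => by
      rw [← AddCircle.coe_nsmul, ← AddCircle.coe_add, UnitAddCircle.norm_eq, nsmul_eq_mul]
    have key := sum_inv_abs_le_of_separated x (cflam_pos hα m) (Finset.range (cfq α (m + 1)))
      (Finset.mem_range.2 hj₀)
      (fun i hi j hj hij => by
        have hi' := Finset.mem_range.1 hi
        have hj' := Finset.mem_range.1 hj
        have := cflam_le_abs_mul_sub hα m (k := (i : ℤ) - j) (by omega)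
          (by rw [abs_lt]; omega) (round (Y + i * α) - round (Y + j * α))
        convert this using 2
        simp only [hx]
        push_cast
        ring)
      (fun i hi => by
        rw [← hnorm, ← hnorm]
        exact hmin i (Finset.mem_range.1 hi))
    rw [Finset.card_range] at key
    simp only [← hnorm] at key
    exact key
end

section
/- Let q be a positive integer, A > 0, and β ∈ T such that ‖n/q − β‖ > A/q for every 0 ≤ n < q. Then Σ_{n=0}^{q−1} 1/‖n/q − β‖ < 2q·(A⁻¹ + log(A⁻¹ q)). -/
theorem sum_range_add_of_periodic {M : Type*} [AddCommMonoid M] {f : ℕ → M} {q : ℕ}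
    (hf : Function.Periodic f q) (m : ℕ) :
    ∑ n ∈ Finset.range q, f (n + m) = ∑ n ∈ Finset.range q, f n := by
  induction m with
  | zero => simp
  | succ m ih =>
    rw [← ih]
    cases q with
    | zero => simp
    | succ p =>
      rw [Finset.sum_range_succ, Finset.sum_range_succ' (fun n => f (n + m))]
      have h1 : f (p + (m + 1)) = f (0 + m) := by
        rw [← hf (0 + m)]
        congr 1
        omega
      rw [h1]
      congr 1
      refine Finset.sum_congr rfl fun n _ => ?_
      congr 1
      omega

theorem sum_range_inv_add_le {A : ℝ} (hA : 0 < A) (q : ℕ) :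
    ∑ n ∈ Finset.range (q + 1), ((n : ℝ) + A)⁻¹ ≤ A⁻¹ + Real.log ((q + A) / A) := by
  induction q with
  | zero => simp [hA.ne']
  | succ q ih =>
    rw [Finset.sum_range_succ]
    have hq : (0 : ℝ) < q + A := by positivity
    have hq' : (0 : ℝ) < (q + 1 : ℕ) + A := by positivity
    have h1 := Real.log_le_sub_one_of_pos (div_pos hq hq')
    rw [Real.log_div hq.ne' hq'.ne'] at h1
    rw [Real.log_div hq.ne' hA.ne'] at ih
    rw [Real.log_div hq'.ne' hA.ne']
    have h2 : ((q : ℝ) + A) / ((q + 1 : ℕ) + A) - 1 = -(((q + 1 : ℕ) : ℝ) + A)⁻¹ := by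
      field_simp
      push_cast
      ring
    linarith

theorem UnitAddCircle.norm_coe_eq_min {x : ℝ} (h0 : 0 ≤ x) (h1 : x < 1) :
    ‖(x : UnitAddCircle)‖ = min x (1 - x) := by
  rw [UnitAddCircle.norm_eq, abs_sub_round_eq_min, Int.fract_eq_self.2 ⟨h0, h1⟩]

theorem UnitAddCircle.inv_norm_coe_le {x : ℝ} (h0 : 0 < x) (h1 : x < 1) :
    ‖(x : UnitAddCircle)‖⁻¹ ≤ x⁻¹ + (1 - x)⁻¹ := by
  have hx : 0 < x⁻¹ := inv_pos.2 h0
  have hx' : 0 < (1 - x)⁻¹ := inv_pos.2 (sub_pos.2 h1)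
  rw [UnitAddCircle.norm_coe_eq_min h0.le h1]
  rcases min_choice x (1 - x) with h | h <;> rw [h] <;> linarith

/-- The bound for the coset `(k + s) / q`, with `s` at distance more than `A` from `0` and `1`. -/
theorem sum_inv_norm_add_div_lt {q : ℕ} (hq : 0 < q) {A s : ℝ} (hA : 0 < A) (hs : A < s)
    (hs' : A < 1 - s) :
    ∑ k ∈ Finset.range q, ‖((((k : ℝ) + s) / q : ℝ) : UnitAddCircle)‖⁻¹ <
      2 * (q : ℝ) * (A⁻¹ + Real.log (A⁻¹ * q)) := by
  have hq0 : (0 : ℝ) < q := by exact_mod_cast hq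
  have key : ∀ k ∈ Finset.range q, ‖((((k : ℝ) + s) / q : ℝ) : UnitAddCircle)‖⁻¹ ≤
      q * ((k : ℝ) + A)⁻¹ + q * (((q - 1 - k : ℕ) : ℝ) + A)⁻¹ := by
    intro k hk
    have hk' : k + 1 ≤ q := Finset.mem_range.1 hk
    have hkq : (k : ℝ) + 1 ≤ q := by exact_mod_cast hk'
    have hk0 : (0 : ℝ) ≤ k := k.cast_nonneg
    have hc : ((q - 1 - k : ℕ) : ℝ) = q - 1 - k := by
      rw [Nat.sub_sub, Nat.cast_sub (by omega)]
      push_cast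
      ring
    refine (UnitAddCircle.inv_norm_coe_le (div_pos (by linarith) hq0)
      ((div_lt_one hq0).2 (by linarith))).trans ?_
    have h1 : 1 - ((k : ℝ) + s) / q = (q - 1 - k + (1 - s)) / q := by
      field_simp
      ring
    rw [hc, h1, inv_div, inv_div, div_eq_mul_inv, div_eq_mul_inv]
    have h2 : (0 : ℝ) < q - 1 - k + A := by linarith
    gcongr
  refine (Finset.sum_le_sum key).trans_lt ?_
  rw [Finset.sum_add_distrib, Finset.sum_range_reflect (fun k : ℕ => (q : ℝ) * ((k : ℝ) + A)⁻¹) q,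
    ← Finset.mul_sum]
  obtain ⟨p, rfl⟩ : ∃ p, q = p + 1 := ⟨q - 1, by omega⟩
  have h1 := sum_range_inv_add_le hA p
  have h2 : Real.log ((p + A) / A) < Real.log (A⁻¹ * (p + 1 : ℕ)) := by
    apply Real.log_lt_log (by positivity)
    rw [div_eq_inv_mul]
    push_cast
    gcongr
    linarith
  have h3 := mul_lt_mul_of_pos_left (h1.trans_lt (add_lt_add_right h2 A⁻¹)) hq0
  linarith

/-- Let `q` be a positive integer, `A > 0`, and `β ∈ T = ℝ/ℤ`
with `‖n/q − β‖ > A/q` for every `0 ≤ n < q`.  Then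
`Σ_{n<q} ‖n/q − β‖⁻¹ < 2q (A⁻¹ + log(A⁻¹ q))`. -/
theorem stmt_8 (q : ℕ) (hq : 0 < q) (A : ℝ) (hA : 0 < A) (β : UnitAddCircle)
    (h : ∀ n < q, A / (q : ℝ) < ‖(((n : ℝ) / (q : ℝ) : ℝ) : UnitAddCircle) - β‖) :
    ∑ n ∈ Finset.range q, ‖(((n : ℝ) / (q : ℝ) : ℝ) : UnitAddCircle) - β‖⁻¹ <
      2 * (q : ℝ) * (A⁻¹ + Real.log (A⁻¹ * q)) := by
  have hq0 : (0 : ℝ) < q := by exact_mod_cast hq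
  obtain ⟨c, hc0, hc⟩ : ∃ c : ℝ, 0 ≤ c ∧ (c : UnitAddCircle) = -β := by
    obtain ⟨b, hb⟩ := QuotientAddGroup.mk_surjective (-β)
    refine ⟨Int.fract b, Int.fract_nonneg b, ?_⟩
    rw [← hb, Int.fract, AddCircle.coe_sub]
    have : ((⌊b⌋ : ℝ) : UnitAddCircle) = 0 := by
      rw [AddCircle.coe_eq_zero_iff]
      exact ⟨⌊b⌋, by simp⟩
    rw [this, sub_zero]
  set m := ⌊q * c⌋₊
  set s := q * c - m with hs
  have hs0 : 0 ≤ s := sub_nonneg.2 (Nat.floor_le (by positivity))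
  have hs1 : s < 1 := by
    have := Nat.lt_floor_add_one (q * c)
    simp only [hs]
    linarith
  set G : ℕ → ℝ := fun k => ‖((((k : ℝ) + s) / q : ℝ) : UnitAddCircle)‖ with hG
  have hper : Function.Periodic G q := by
    intro k
    have : (((k + q : ℕ) : ℝ) + s) / q = (k + s) / q + 1 := by
      push_cast
      field_simp
      ring
    simp only [hG]
    rw [this, AddCircle.coe_add, AddCircle.coe_period, add_zero]
  have hGm : ∀ n : ℕ, ‖(((n : ℝ) / (q : ℝ) : ℝ) : UnitAddCircle) - β‖ = G (n + m) := by
    intro n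
    have : (((n + m : ℕ) : ℝ) + s) / q = n / q + c := by
      rw [hs]
      push_cast
      field_simp
      ring
    simp only [hG]
    rw [this, AddCircle.coe_add, hc, sub_eq_add_neg]
  have hlow : ∀ k, A / q < G k := by
    intro k
    have hn := h _ (Nat.mod_lt (k + (q - 1) * m) hq)
    rw [hGm] at hn
    have h1 : G ((k + (q - 1) * m) % q + m) = G (k + (q - 1) * m + m) :=
      Function.Periodic.map_mod_nat (f := fun j => G (j + m))
        (fun j => by
          show G (j + q + m) = G (j + m)
          rw [add_right_comm, hper]) _
    have h2 : k + (q - 1) * m + m = k + m * q := by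
      obtain ⟨p, rfl⟩ : ∃ p, q = p + 1 := ⟨q - 1, by omega⟩
      simp only [Nat.add_sub_cancel]
      ring
    have h3 : G (k + m * q) = G k := by simpa using hper.nat_mul m k
    rwa [h1, h2, h3] at hn
  have hsA : A < s := by
    have h0 := hlow 0
    have hx : s / q < 1 := by
      rw [div_lt_one hq0]
      have : (1 : ℝ) ≤ q := by exact_mod_cast hq
      linarith
    simp only [hG, Nat.cast_zero, zero_add] at h0
    rw [UnitAddCircle.norm_coe_eq_min (by positivity) hx] at h0
    exact (div_lt_div_iff_of_pos_right hq0).1 (h0.trans_le (min_le_left _ _))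
  have hsA' : A < 1 - s := by
    have h0 := hlow (q - 1)
    have hcast : ((q - 1 : ℕ) : ℝ) = q - 1 := by
      rw [Nat.cast_sub hq, Nat.cast_one]
    have h1 : (1 : ℝ) ≤ q := by exact_mod_cast hq
    simp only [hG, hcast] at h0
    rw [UnitAddCircle.norm_coe_eq_min (div_nonneg (by linarith) hq0.le)
      ((div_lt_one hq0).2 (by linarith))] at h0
    have h2 : 1 - ((q : ℝ) - 1 + s) / q = (1 - s) / q := by
      field_simp
      ring
    rw [h2] at h0
    exact (div_lt_div_iff_of_pos_right hq0).1 (h0.trans_le (min_le_right _ _))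
  simp only [hGm]
  rw [sum_range_add_of_periodic (f := fun k => (G k)⁻¹) (fun k => by simp only [hper k]) m]
  exact sum_inv_norm_add_div_lt hq hA hsA hsA'
end

section
/- Let α be irrational, n > 0, and ℓ ≥ 1 an integer with ℓ q_n < q_{n+1}. Then for every x ∈ E_{n,ℓ} one has Σ_{k=0}^{ℓ q_n − 1} 1/‖x + kα‖ ≥ log(ℓ)/λ^{(n)}. -/
lemma sum_range_center_split (g : ℕ → ℝ) (s u : ℕ) :
    ∑ t ∈ Finset.range (s + 1 + u), g t =
      ∑ j ∈ Finset.range s, g (s - 1 - j) + g s + ∑ j ∈ Finset.range u, g (s + 1 + j) := by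
  rw [Finset.sum_range_add, Finset.sum_range_succ, Finset.sum_range_reflect]

lemma log_succ_le_sum_inv (m : ℕ) :
    Real.log ((m : ℝ) + 1) ≤ ∑ j ∈ Finset.range m, ((j : ℝ) + 1)⁻¹ := by
  have h := log_add_one_le_harmonic m
  simpa [harmonic] using h

lemma log_add_le_sum_inv_add_sum_inv (s u : ℕ) :
    Real.log ((s : ℝ) + 1 + u) ≤
      ∑ j ∈ Finset.range s, ((j : ℝ) + 1)⁻¹ + ∑ j ∈ Finset.range u, ((j : ℝ) + 1)⁻¹ := by
  have hs : (0 : ℝ) ≤ s := s.cast_nonneg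
  have hu : (0 : ℝ) ≤ u := u.cast_nonneg
  calc Real.log ((s : ℝ) + 1 + u) ≤ Real.log (((s : ℝ) + 1) * (u + 1)) :=
        Real.log_le_log (by positivity) (by nlinarith [mul_nonneg hs hu])
    _ = Real.log ((s : ℝ) + 1) + Real.log ((u : ℝ) + 1) :=
        Real.log_mul (by positivity) (by positivity)
    _ ≤ _ := add_le_add (log_succ_le_sum_inv s) (log_succ_le_sum_inv u)

lemma sum_progression_le_sum_range {f : ℕ → ℝ} (hf : ∀ k, 0 ≤ f k) {q r : ℕ} (hr : r < q)
    (ℓ : ℕ) :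
    ∑ t ∈ Finset.range ℓ, f (r + t * q) ≤ ∑ k ∈ Finset.range (ℓ * q), f k := by
  have hinj : Set.InjOn (fun t : ℕ => r + t * q) (Finset.range ℓ) := fun a _ b _ h =>
    Nat.eq_of_mul_eq_mul_right (by omega : 0 < q) (Nat.add_left_cancel h)
  rw [← Finset.sum_image (f := f) hinj]
  refine Finset.sum_le_sum_of_subset_of_nonneg ?_ fun k _ _ => hf k
  intro k hk
  obtain ⟨t, ht, rfl⟩ := Finset.mem_image.mp hk
  have ht : t + 1 ≤ ℓ := Finset.mem_range.mp ht
  have := Nat.mul_le_mul_right q ht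
  rw [Finset.mem_range]
  linarith [add_mul t 1 q]

lemma inv_mul_inv_le_inv_norm {G : Type*} [NormedAddCommGroup G] {z : G} {c lam : ℝ}
    (hz : z ≠ 0) (h : ‖z‖ ≤ c * lam) : c⁻¹ * lam⁻¹ ≤ ‖z‖⁻¹ := by
  rw [← mul_inv]
  exact inv_anti₀ (norm_pos_iff.mpr hz) h

/-- If an orbit segment of length `ℓ * q` of a translation by a torsion-free element `a` comes
within `lam / 2` of `0`, where `‖q • a‖ ≤ lam`, then the sum of the inverse norms along this
segment is at least `log ℓ / lam`. -/
theorem log_div_le_sum_inv_norm {G : Type*} [NormedAddCommGroup G] {a x : G}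
    (ha : ∀ m : ℕ, m ≠ 0 → m • a ≠ 0) {q ℓ k : ℕ} {lam : ℝ} (hlam : 0 < lam)
    (hqa : ‖q • a‖ ≤ lam) (hk : k < ℓ * q) (hxk : ‖x + k • a‖ ≤ lam / 2) :
    Real.log ℓ / lam ≤ ∑ k ∈ Finset.range (ℓ * q), ‖x + k • a‖⁻¹ := by
  wlog hc : x + k • a = 0 ∨ ∀ j < ℓ * q, x + j • a ≠ 0 generalizing k
  · obtain ⟨-, j, hj, hj0⟩ : x + k • a ≠ 0 ∧ ∃ j < ℓ * q, x + j • a = 0 := by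
      push Not at hc
      exact hc
    exact this hj (by rw [hj0, norm_zero]; positivity) (Or.inl hj0)
  have hq : 0 < q := Nat.pos_of_ne_zero fun h => by simp [h] at hk
  obtain ⟨r, s, hr, rfl⟩ : ∃ r s, r < q ∧ r + s * q = k :=
    ⟨k % q, k / q, Nat.mod_lt _ hq, Nat.mod_add_div' k q⟩
  have hs : s < ℓ := Nat.lt_of_mul_lt_mul_right (lt_of_le_of_lt (Nat.le_add_left _ r) hk)
  obtain ⟨u, rfl⟩ : ∃ u, ℓ = s + 1 + u := ⟨ℓ - (s + 1), by omega⟩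
  set z : ℕ → G := fun t => x + (r + t * q) • a with hz
  have hmem : ∀ t < s + 1 + u, r + t * q < (s + 1 + u) * q := fun t ht => by
    have := Nat.mul_le_mul_right q (Nat.succ_le_of_lt ht)
    rw [Nat.succ_mul] at this
    omega
  have hstep : ∀ t d, z (t + d) = z t + d • q • a := fun t d => by
    simp only [hz, add_smul, mul_smul, add_assoc]
  have hd : ∀ d : ℕ, ‖d • q • a‖ ≤ d * lam := fun d =>
    norm_nsmul_le.trans (mul_le_mul_of_nonneg_left hqa d.cast_nonneg)
  have hright : ∀ j, ‖z (s + 1 + j)‖ ≤ ‖z s‖ + (j + 1 : ℝ) * lam := fun j => by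
    rw [add_assoc, hstep]
    refine (norm_add_le _ _).trans (add_le_add_right ((hd _).trans_eq ?_) _)
    push_cast
    ring
  have hleft : ∀ j < s, ‖z (s - 1 - j)‖ ≤ ‖z s‖ + (j + 1 : ℝ) * lam := fun j hj => by
    have h := hstep (s - 1 - j) (j + 1)
    rw [show s - 1 - j + (j + 1) = s by omega] at h
    rw [eq_sub_of_add_eq h.symm]
    refine (norm_sub_le _ _).trans (add_le_add_right ((hd _).trans_eq ?_) _)
    push_cast
    ring
  refine le_trans ?_ (sum_progression_le_sum_range
    (f := fun k => ‖x + k • a‖⁻¹) (fun k => by positivity) hr (s + 1 + u))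
  change _ ≤ ∑ t ∈ Finset.range (s + 1 + u), ‖z t‖⁻¹
  rw [sum_range_center_split (fun t => ‖z t‖⁻¹), div_eq_mul_inv]
  have hlog := log_add_le_sum_inv_add_sum_inv
  have hlam' : 0 ≤ lam⁻¹ := by positivity
  push_cast
  rcases hc with h0 | hne
  · have hzs : z s = 0 := h0
    rw [hzs, norm_zero] at hright hleft
    have hzr : ∀ j, z (s + 1 + j) ≠ 0 := fun j => by
      rw [add_assoc, hstep, hzs, zero_add, ← mul_smul]
      exact ha _ (by positivity)
    have hzl : ∀ j < s, z (s - 1 - j) ≠ 0 := fun j hj h => by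
      have h' := hstep (s - 1 - j) (j + 1)
      rw [show s - 1 - j + (j + 1) = s by omega, hzs, h, zero_add, ← mul_smul] at h'
      exact ha _ (by positivity) h'.symm
    have h1 : ∑ j ∈ Finset.range s, ((j : ℝ) + 1)⁻¹ * lam⁻¹ ≤
        ∑ j ∈ Finset.range s, ‖z (s - 1 - j)‖⁻¹ := Finset.sum_le_sum fun j hj => by
      have hj := Finset.mem_range.mp hj
      exact inv_mul_inv_le_inv_norm (hzl j hj) (by simpa using hleft j hj)
    have h2 : ∑ j ∈ Finset.range u, ((j : ℝ) + 1)⁻¹ * lam⁻¹ ≤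
        ∑ j ∈ Finset.range u, ‖z (s + 1 + j)‖⁻¹ := Finset.sum_le_sum fun j _ =>
      inv_mul_inv_le_inv_norm (hzr j) (by simpa using hright j)
    have h3 := mul_le_mul_of_nonneg_right (hlog s u) hlam'
    rw [add_mul, Finset.sum_mul, Finset.sum_mul] at h3
    rw [hzs, norm_zero, inv_zero]
    linarith
  · have hzne : ∀ t < s + 1 + u, z t ≠ 0 := fun t ht => hne _ (hmem t ht)
    have hzs : ‖z s‖ ≤ lam / 2 := hxk
    have h1 : ∑ j ∈ Finset.range s, (((j + 1 : ℕ) : ℝ) + 1)⁻¹ * lam⁻¹ ≤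
        ∑ j ∈ Finset.range s, ‖z (s - 1 - j)‖⁻¹ := Finset.sum_le_sum fun j hj => by
      have hj := Finset.mem_range.mp hj
      refine inv_mul_inv_le_inv_norm (hzne _ (by omega)) ?_
      push_cast
      linarith [hleft j hj]
    have h2 : ∑ j ∈ Finset.range u, (((j + 1 : ℕ) : ℝ) + 1)⁻¹ * lam⁻¹ ≤
        ∑ j ∈ Finset.range u, ‖z (s + 1 + j)‖⁻¹ := Finset.sum_le_sum fun j hj => by
      have hj := Finset.mem_range.mp hj
      refine inv_mul_inv_le_inv_norm (hzne _ (by omega)) ?_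
      push_cast
      linarith [hright j]
    have h0 : (1 / 2 : ℝ)⁻¹ * lam⁻¹ ≤ ‖z s‖⁻¹ :=
      inv_mul_inv_le_inv_norm (hzne s (by omega)) (by linarith)
    have h3 := mul_le_mul_of_nonneg_right (hlog (s + 1) (u + 1)) hlam'
    rw [add_mul, Finset.sum_mul, Finset.sum_mul, Finset.sum_range_succ',
      Finset.sum_range_succ'] at h3
    have h4 : Real.log ((s : ℝ) + 1 + u) ≤ Real.log (((s + 1 : ℕ) : ℝ) + 1 + (u + 1 : ℕ)) :=
      Real.log_le_log (by positivity) (by push_cast; linarith)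
    have h5 := mul_le_mul_of_nonneg_right h4 hlam'
    norm_num at h0 h1 h2 h3 h5 ⊢
    linarith

lemma nsmul_coe_unitAddCircle_ne_zero {α : ℝ} (hα : Irrational α) (m : ℕ) (hm : m ≠ 0) :
    m • (α : UnitAddCircle) ≠ 0 := by
  rw [← AddCircle.coe_nsmul, Ne, AddCircle.coe_eq_zero_iff]
  rintro ⟨n, hn⟩
  rw [nsmul_eq_mul, zsmul_eq_mul, mul_one] at hn
  exact (hα.natCast_mul hm).ne_int n hn.symm

lemma norm_cfq_nsmul_le_cflam (α : ℝ) (n : ℕ) :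
    ‖cfq α n • (α : UnitAddCircle)‖ ≤ cflam α n := by
  rw [← AddCircle.coe_nsmul, UnitAddCircle.norm_eq, nsmul_eq_mul]
  exact round_le _ _

/-- Let `α` be irrational, `n > 0`, and `ℓ ≥ 1` with
`ℓ qₙ < q_{n+1}`.  Then every `x ∈ E_{n,ℓ}` satisfies
`Σ_{k < ℓqₙ} ‖x + kα‖⁻¹ ≥ log(ℓ)/λ⁽ⁿ⁾`. -/
theorem stmt_11 (α : ℝ) (hα : Irrational α) (n : ℕ) (hn : 0 < n)
    (ℓ : ℕ) (hℓ : 1 ≤ ℓ) (hlt : ℓ * cfq α n < cfq α (n + 1))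
    (x : UnitAddCircle)
    (hx : x ∈ ⋃ k ∈ Finset.range (ℓ * cfq α n),
      (fun z : UnitAddCircle => z + k • (α : UnitAddCircle)) ⁻¹'
        {z : UnitAddCircle | ‖z‖ < cflam α n / 2}) :
    Real.log ℓ / cflam α n ≤
      ∑ k ∈ Finset.range (ℓ * cfq α n), ‖x + k • (α : UnitAddCircle)‖⁻¹ := by
  simp only [Set.mem_iUnion, Finset.mem_range, Set.mem_preimage, Set.mem_ofPred_eq] at hx
  obtain ⟨k, hk, hxk⟩ := hx
  have hlam : 0 < cflam α n := by linarith [norm_nonneg (x + k • (α : UnitAddCircle))]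
  exact log_div_le_sum_inv_norm (nsmul_coe_unitAddCircle_ne_zero hα) hlam
    (norm_cfq_nsmul_le_cflam α n) hk hxk.le
end

section
/- Let α be a Liouville number, meaning that for every k > 0 there are infinitely many n with a_{n+1} > q_n^k. Then for every K > 1, every β₀ ∈ T and every ε > 0 there exist an integer m ≥ 1 and β ∈ T with ‖β − β₀‖ ≤ ε such that the set {x ∈ T : Σ_{k=0}^{m−1} 1/‖x + kα‖ > K · Σ_{k=0}^{m−1} 1/‖x + kα − β‖} has normalized Haar measure at least 1/16. -/
theorem cfQuot_sub_floor_pos {α : ℝ} (hα : Irrational α) (n : ℕ) :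
    0 < cfQuot α n - ⌊cfQuot α n⌋ :=
  Int.fract_pos.2 ((irrational_cfQuot hα n).ne_int _)

theorem one_lt_cfQuot_succ {α : ℝ} (hα : Irrational α) (n : ℕ) : 1 < cfQuot α (n + 1) :=
  (one_lt_inv₀ (cfQuot_sub_floor_pos hα n)).2 (Int.fract_lt_one _)

theorem cfa_succ_eq_floor {α : ℝ} (hα : Irrational α) (n : ℕ) :
    (cfa α (n + 1) : ℝ) = ⌊cfQuot α (n + 1)⌋ := by
  have h : (0 : ℤ) ≤ ⌊cfQuot α (n + 1)⌋ := Int.floor_nonneg.2 (by linarith [one_lt_cfQuot_succ hα n])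
  rw [cfa, ← Int.cast_natCast, Int.toNat_of_nonneg h]

theorem cfa_succ_le {α : ℝ} (hα : Irrational α) (n : ℕ) :
    (cfa α (n + 1) : ℝ) ≤ cfQuot α (n + 1) := by
  rw [cfa_succ_eq_floor hα]
  exact Int.floor_le _

theorem cfQuot_succ_mul {α : ℝ} (hα : Irrational α) (n : ℕ) :
    cfQuot α (n + 2) * (cfQuot α (n + 1) - cfa α (n + 1)) = 1 := by
  rw [cfa_succ_eq_floor hα]
  exact inv_mul_cancel₀ (cfQuot_sub_floor_pos hα (n + 1)).ne'

theorem cfrho_add_cfrho_succ_mul {α : ℝ} (hα : Irrational α) (n : ℕ) :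
    cfrho α n + cfrho α (n + 1) * cfQuot α (n + 2) = 0 := by
  induction n with
  | zero =>
    have h1 : cfQuot α 1 * (α - ⌊α⌋) = 1 := inv_mul_cancel₀ (cfQuot_sub_floor_pos hα 0).ne'
    have h2 := cfQuot_succ_mul hα 0
    simp only [cfrho, cfq, cfp, zero_add] at *
    push_cast
    linear_combination (-(α - ⌊α⌋)) * h2 + cfQuot α 2 * h1
  | succ n ih =>
    have h2 := cfQuot_succ_mul hα (n + 1)
    have h3 : cfrho α (n + 2) = cfa α (n + 2) * cfrho α (n + 1) + cfrho α n := by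
      simp only [cfrho, cfq, cfp]
      push_cast
      ring
    rw [show n + 1 + 1 = n + 2 from rfl, h3]
    linear_combination (-cfrho α (n + 1)) * h2 + cfQuot α (n + 3) * ih

theorem abs_cfrho_mul_cfQuot_le_one {α : ℝ} (hα : Irrational α) (n : ℕ) :
    |cfrho α n| * cfQuot α (n + 1) ≤ 1 := by
  induction n with
  | zero =>
    have h : 0 < α - ⌊α⌋ := cfQuot_sub_floor_pos hα 0
    have h1 : cfQuot α 1 * (α - ⌊α⌋) = 1 := inv_mul_cancel₀ h.ne'
    have h2 : cfrho α 0 = α - ⌊α⌋ := by simp [cfrho, cfq, cfp]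
    rw [zero_add, h2, abs_of_pos h, mul_comm]
    exact h1.le
  | succ n ih =>
    have hx := one_lt_cfQuot_succ hα n
    have hy := one_lt_cfQuot_succ hα (n + 1)
    have h : |cfrho α n| = |cfrho α (n + 1)| * cfQuot α (n + 2) := by
      rw [eq_neg_of_add_eq_zero_left (cfrho_add_cfrho_succ_mul hα n), abs_neg, abs_mul,
        abs_of_pos (zero_lt_one.trans hy)]
    rw [← h]
    nlinarith [abs_nonneg (cfrho α n)]

theorem le_cfq {α : ℝ} (hα : Irrational α) : ∀ n, n ≤ cfq α n ∧ 1 ≤ cfq α n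
  | 0 => by simp [cfq]
  | 1 => by simpa [cfq] using one_le_cfa_succ hα 0
  | n + 2 => by
    have h0 := le_cfq hα n
    have h1 := le_cfq hα (n + 1)
    have ha := one_le_cfa_succ hα (n + 1)
    simp only [cfq]
    constructor <;> nlinarith

theorem isCoprime_cfp_cfq (α : ℝ) (n : ℕ) : IsCoprime (cfp α n) (cfq α n : ℤ) := by
  refine ⟨(-1) ^ (n + 1) * cfq α (n + 1), (-1) ^ n * cfp α (n + 1), ?_⟩
  have h := cfp_mul_cfq_sub α n
  have h2 : ((-1 : ℤ) ^ n) * (-1) ^ n = 1 := by rw [← mul_pow]; simp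
  rw [pow_succ]
  linear_combination (-1) ^ n * h + h2

/-- Inverse distance to the integers of a point close to, and slightly below, `n / q`. -/
theorem inv_norm_coe_div_le {q : ℕ} (hq : 1 ≤ q) (n : ℤ) {w : ℝ} (h1 : -(3 / 4) ≤ w)
    (h2 : w ≤ -(1 / 4)) :
    ‖(((n + w) / q : ℝ) : UnitAddCircle)‖⁻¹ ≤
      8 * q * (((n % q).toNat + 1 : ℝ)⁻¹ + (q - (n % q).toNat : ℝ)⁻¹) := by
  have hq0 : (0 : ℤ) < q := by exact_mod_cast hq
  have hqR : (0 : ℝ) < q := by exact_mod_cast hq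
  set i := (n % q).toNat with hi
  have hi' : (i : ℤ) = n % q := Int.toNat_of_nonneg (Int.emod_nonneg _ hq0.ne')
  have hlt : (i : ℤ) < q := hi' ▸ Int.emod_lt_of_pos _ hq0
  have hlt' : (i : ℝ) + 1 ≤ q := by exact_mod_cast hlt
  have hi0 : (0 : ℝ) ≤ i := Nat.cast_nonneg i
  rw [UnitAddCircle.norm_eq]
  set z := round ((n + w) / q : ℝ)
  set e : ℤ := n / q - z with he
  have hn : (n : ℝ) = i + q * (e + z) := by
    have : n = i + q * (e + z) := by
      rw [hi', he]
      have := Int.emod_add_mul_ediv n q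
      linarith
    exact_mod_cast this
  have hv : (n + w) / q - z = (i + w + q * e) / q := by
    rw [hn]
    field_simp
    ring
  rw [hv, abs_div, abs_of_pos hqR, inv_div, div_eq_mul_inv]
  have key : ∀ a : ℝ, 0 < a → a / 8 ≤ |i + w + q * e| → (|i + w + q * e|)⁻¹ ≤ 8 * a⁻¹ := by
    intro a ha h
    calc (|i + w + q * e|)⁻¹ ≤ (a / 8)⁻¹ := inv_anti₀ (by positivity) h
      _ = 8 * a⁻¹ := by rw [inv_div, div_eq_mul_inv]
  have hp1 : (0 : ℝ) ≤ (i + 1 : ℝ)⁻¹ := by positivity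
  have hp2 : (0 : ℝ) ≤ (q - i : ℝ)⁻¹ := inv_nonneg.2 (by linarith)
  have : (|i + w + q * e|)⁻¹ ≤ 8 * ((i + 1 : ℝ)⁻¹ + (q - i : ℝ)⁻¹) := by
    rcases le_or_gt 0 e with h | h
    · refine (key (i + 1) (by positivity) ?_).trans (by linarith)
      rcases h.eq_or_lt with h | h
      · rw [← h]
        rcases Nat.eq_zero_or_pos i with h0 | h0
        · rw [h0]
          have := neg_le_abs (w)
          simp
          linarith
        · have h0' : (1 : ℝ) ≤ i := by exact_mod_cast h0
          refine le_trans ?_ (le_abs_self _)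
          push_cast
          linarith
      · have h' : (1 : ℝ) ≤ e := by exact_mod_cast h
        refine le_trans ?_ (le_abs_self _)
        nlinarith
    · have h' : (e : ℝ) ≤ -1 := by exact_mod_cast (show e ≤ -1 by omega)
      refine (key (q - i) (by linarith) ?_).trans (by linarith)
      refine le_trans ?_ (neg_le_abs _)
      nlinarith
  nlinarith

theorem bijOn_emod_range {q : ℕ} (hq : 1 ≤ q) {p : ℤ} (hp : IsCoprime p (q : ℤ)) (e : ℤ) :
    Set.BijOn (fun i : ℕ => ((e + i * p) % q).toNat) (Finset.range q) (Finset.range q) := by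
  have hq0 : (0 : ℤ) < q := by exact_mod_cast hq
  have hmaps : Set.MapsTo (fun i : ℕ => ((e + i * p) % q).toNat)
      (Finset.range q) (Finset.range q) := by
    intro i _
    have h1 := Int.emod_nonneg (e + i * p) hq0.ne'
    have h2 := Int.emod_lt_of_pos (e + i * p) hq0
    simp only [Finset.coe_range, Set.mem_Iio]
    omega
  have hinj : Set.InjOn (fun i : ℕ => ((e + i * p) % q).toNat) (Finset.range q) := by
    intro i hi j hj hij
    have h1 := Int.emod_nonneg (e + i * p) hq0.ne'
    have h2 := Int.emod_nonneg (e + j * p) hq0.ne'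
    have h3 : (e + i * p) % q = (e + j * p) % q := by
      simp only at hij
      omega
    have h4 : (q : ℤ) ∣ (j - i) * p := by
      convert Int.ModEq.dvd h3 using 1
      ring
    have h5 : (q : ℤ) ∣ j - i := hp.symm.dvd_of_dvd_mul_right h4
    simp only [Finset.coe_range, Set.mem_Iio] at hi hj
    have h6 := Int.eq_zero_of_abs_lt_dvd h5 (by rw [abs_lt]; constructor <;> omega)
    omega
  exact ⟨hmaps, hinj, Finset.surjOn_of_injOn_of_card_le _ hmaps hinj le_rfl⟩

theorem sum_range_mul_add {A : Type*} [AddCommMonoid A] (f : ℕ → A) (M q : ℕ) :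
    ∑ k ∈ Finset.range (M * q), f k =
      ∑ j ∈ Finset.range M, ∑ i ∈ Finset.range q, f (j * q + i) := by
  induction M with
  | zero => simp
  | succ M ih => rw [Nat.succ_mul, Finset.sum_range_add, ih, Finset.sum_range_succ]

theorem sum_inv_add_inv_reflect_le {q : ℕ} :
    ∑ i ∈ Finset.range q, 8 * (q : ℝ) * ((i + 1 : ℝ)⁻¹ + (q - i : ℝ)⁻¹) ≤
      16 * q * (1 + Real.log q) := by
  have h1 : ∑ i ∈ Finset.range q, (i + 1 : ℝ)⁻¹ ≤ 1 + Real.log q := by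
    have := harmonic_le_one_add_log q
    simpa [harmonic] using this
  have h2 : ∑ i ∈ Finset.range q, (q - i : ℝ)⁻¹ = ∑ i ∈ Finset.range q, (i + 1 : ℝ)⁻¹ := by
    rw [← Finset.sum_range_reflect (fun i : ℕ => (i + 1 : ℝ)⁻¹)]
    refine Finset.sum_congr rfl fun i hi => ?_
    have hi' : i + 1 ≤ q := Finset.mem_range.1 hi
    rw [Nat.sub_sub, Nat.cast_sub (by omega)]
    push_cast
    congr 1
    ring
  rw [← Finset.mul_sum, Finset.sum_add_distrib, h2]
  have : (0 : ℝ) ≤ q := Nat.cast_nonneg q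
  nlinarith

theorem log_sub_one_le_sum_inv (N : ℕ) :
    Real.log (N + 2) - 1 ≤ ∑ i ∈ Finset.range N, (i + 2 : ℝ)⁻¹ := by
  have h := log_add_one_le_harmonic (N + 1)
  have h2 : ((harmonic (N + 1) : ℚ) : ℝ) = ∑ i ∈ Finset.range N, (i + 2 : ℝ)⁻¹ + 1 := by
    rw [harmonic, Finset.sum_range_succ']
    push_cast
    simp [add_assoc, one_add_one_eq_two]
  rw [h2] at h
  push_cast at h
  rw [add_assoc, one_add_one_eq_two] at h
  linarith

theorem sum_inv_norm_le {α R y τ s : ℝ} {q M : ℕ} {p b c : ℤ} (hq : 1 ≤ q)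
    (hp : IsCoprime p (q : ℤ)) (hs : |s| = 1) (hα : q * α = p + s * R) (hR : 0 < R)
    (hM : M * (q * R) ≤ 1 / 4) (hτ0 : 0 ≤ τ) (hτ : τ ≤ 1 / 4) (hy : q * y = c - s * τ) :
    ∑ k ∈ Finset.range (M * q), ‖(y : UnitAddCircle) + k • (α : UnitAddCircle)
        - (((b + 1 / 2) / q : ℝ) : UnitAddCircle)‖⁻¹ ≤
      M * (16 * q * (1 + Real.log q)) := by
  have hqR : (0 : ℝ) < q := by exact_mod_cast hq
  rw [sum_range_mul_add, ← nsmul_eq_mul, ← Finset.card_range M, ← Finset.sum_const]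
  simp only [Finset.card_range]
  refine Finset.sum_le_sum fun j hj => le_trans ?_ sum_inv_add_inv_reflect_le
  have hj' : j + 1 ≤ M := Finset.mem_range.1 hj
  have hb := bijOn_emod_range hq hp (c - b + j * q * p)
  refine le_of_le_of_eq ?_ (Finset.sum_nbij _ hb.mapsTo hb.injOn hb.surjOn (fun _ _ => rfl))
  refine Finset.sum_le_sum fun i hi => ?_
  have hi' : i + 1 ≤ q := Finset.mem_range.1 hi
  have hk : ((j * q + i : ℕ) : ℝ) ≤ M * q := by
    have : j * q + i ≤ M * q := by nlinarith
    exact_mod_cast this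
  set k := j * q + i with hk_def
  have hkR : k * R ≤ 1 / 4 := by nlinarith
  have hkR0 : 0 ≤ k * R := by positivity
  have hw : |s * (k * R - τ)| ≤ 1 / 4 := by
    rw [abs_mul, hs, one_mul, abs_le]
    constructor <;> linarith
  obtain ⟨hw1, hw2⟩ := abs_le.1 hw
  have := inv_norm_coe_div_le hq (c - b + j * q * p + i * p) (w := s * (k * R - τ) - 1 / 2)
    (by linarith) (by linarith)
  refine le_of_eq_of_le (congrArg (fun z : UnitAddCircle => ‖z‖⁻¹) ?_) this
  rw [← AddCircle.coe_nsmul, ← AddCircle.coe_add, ← AddCircle.coe_sub]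
  congr 1
  rw [eq_div_iff hqR.ne', nsmul_eq_mul]
  have hkc : (k : ℝ) = j * q + i := by rw [hk_def]; push_cast; ring
  field_simp
  push_cast
  linear_combination 2 * hy + 2 * k * hα + 2 * p * hkc

theorem le_sum_inv_norm {α R y τ s : ℝ} {q J N : ℕ} {p c : ℤ} (hq : 1 ≤ q)
    (hp : IsCoprime p (q : ℤ)) (hs : |s| = 1) (hα : q * α = p + s * R) (hR : 0 < R)
    (hJ : J * (q * R) ≤ τ) (hJ' : τ < (J + 1) * (q * R))
    (hM : (J + 1 + N) * (q * R) ≤ 1 / 4) (hy : q * y = c - s * τ) :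
    (Real.log (N + 2) - 1) / R ≤ ∑ k ∈ Finset.range ((J + 1 + N) * q),
      ‖(y : UnitAddCircle) + k • (α : UnitAddCircle)‖⁻¹ := by
  have hqR : (1 : ℝ) ≤ q := by exact_mod_cast hq
  have hτ0 : 0 ≤ τ := le_trans (by positivity) hJ
  obtain ⟨i, hi, hi'⟩ := (bijOn_emod_range hq hp c).surjOn
    (show (0 : ℕ) ∈ (Finset.range q : Set ℕ) by simp; omega)
  have hiq : i < q := by simpa using hi
  have hdvd : (q : ℤ) ∣ c + i * p := by
    apply Int.dvd_of_emod_eq_zero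
    have := Int.emod_nonneg (c + i * p) (show (q : ℤ) ≠ 0 by omega)
    simp only at hi'
    omega
  obtain ⟨d, hd⟩ := hdvd
  rw [sum_range_mul_add, Finset.sum_range_add]
  have hnn : ∀ k : ℕ, 0 ≤ ‖(y : UnitAddCircle) + k • (α : UnitAddCircle)‖⁻¹ :=
    fun k => inv_nonneg.2 (norm_nonneg _)
  have hterm : ∀ l ∈ Finset.range N, (l + 2 : ℝ)⁻¹ / R ≤ ∑ i ∈ Finset.range q,
      ‖(y : UnitAddCircle) + ((J + 1 + l) * q + i) • (α : UnitAddCircle)‖⁻¹ := by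
    intro l hl
    have hl' : (l : ℝ) + 1 ≤ N := by exact_mod_cast Finset.mem_range.1 hl
    refine le_trans ?_ (Finset.single_le_sum (f := fun i => ‖(y : UnitAddCircle) +
      ((J + 1 + l) * q + i) • (α : UnitAddCircle)‖⁻¹) (fun k _ => hnn _) hi)
    set k := (J + 1 + l) * q + i with hk
    have hkc : (k : ℝ) = (J + 1 + l) * q + i := by rw [hk]; push_cast; ring
    have hiR : (i : ℝ) + 1 ≤ q := by exact_mod_cast hiq
    have hi0 : (0 : ℝ) ≤ i := Nat.cast_nonneg i
    have hl0 : (0 : ℝ) ≤ l * (q * R) := by positivity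
    have hiRR : (i : ℝ) * R ≤ q * R := by nlinarith
    have hkR : k * R = J * (q * R) + q * R + l * (q * R) + i * R := by rw [hkc]; ring
    have hpos : 0 < k * R - τ := by nlinarith
    have hle : k * R - τ ≤ 1 / 4 := by
      have : ((l : ℝ) + 1) * (q * R) ≤ N * (q * R) := by gcongr
      nlinarith
    have hle' : (k * R - τ) / q ≤ (l + 2) * R := by
      rw [div_le_iff₀ (by linarith)]
      nlinarith
    have heq : (y : UnitAddCircle) + k • (α : UnitAddCircle) =
        ((s * (k * R - τ) / q : ℝ) : UnitAddCircle) := by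
      rw [← AddCircle.coe_nsmul, ← AddCircle.coe_add, ← sub_eq_zero, ← AddCircle.coe_sub,
        AddCircle.coe_eq_zero_iff]
      refine ⟨d + (J + 1 + l) * p, ?_⟩
      have hd' : (c : ℝ) + i * p = q * d := by exact_mod_cast hd
      rw [zsmul_eq_mul, mul_one, nsmul_eq_mul]
      have hq0 : (q : ℝ) ≠ 0 := by linarith
      field_simp
      push_cast
      linear_combination (-1) * hy - k * hα - hd' - p * hkc
    have habs : |s * (k * R - τ) / q| = (k * R - τ) / q := by
      rw [abs_div, abs_mul, hs, one_mul, abs_of_pos hpos, abs_of_pos (by linarith)]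
    have hnorm : ‖((s * (k * R - τ) / q : ℝ) : UnitAddCircle)‖ = (k * R - τ) / q := by
      rw [(AddCircle.norm_coe_eq_abs_iff 1 one_ne_zero).2, habs]
      rw [habs, abs_one, div_le_iff₀ (by linarith)]
      linarith
    rw [heq, hnorm, div_eq_mul_inv, ← mul_inv]
    exact inv_anti₀ (div_pos hpos (by linarith)) hle'
  have h0 : 0 ≤ ∑ j ∈ Finset.range (J + 1), ∑ i ∈ Finset.range q,
      ‖(y : UnitAddCircle) + (j * q + i) • (α : UnitAddCircle)‖⁻¹ :=
    Finset.sum_nonneg fun _ _ => Finset.sum_nonneg fun _ _ => hnn _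
  have h1 := Finset.sum_le_sum hterm
  rw [← Finset.sum_div] at h1
  have h2 : (Real.log (N + 2) - 1) / R ≤ (∑ i ∈ Finset.range N, (i + 2 : ℝ)⁻¹) / R := by
    gcongr
    exact log_sub_one_le_sum_inv N
  linarith

theorem mul_sum_inv_norm_lt {α K R y τ s : ℝ} {q : ℕ} {p b c : ℤ} (hq : 1 ≤ q)
    (hp : IsCoprime p (q : ℤ)) (hs : |s| = 1) (hα : q * α = p + s * R) (hR : 0 < R)
    (hR' : 16 * (q * R) ≤ 1) (hK0 : 0 < K)
    (hK : K * (4 * (1 + Real.log q)) < Real.log (1 / (8 * (q * R))) - 1)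
    (hτ0 : 0 ≤ τ) (hτ : τ ≤ 1 / 8) (hy : q * y = c - s * τ) :
    K * ∑ k ∈ Finset.range (⌊1 / (4 * (q * R))⌋₊ * q), ‖(y : UnitAddCircle) +
        k • (α : UnitAddCircle) - (((b + 1 / 2) / q : ℝ) : UnitAddCircle)‖⁻¹ <
      ∑ k ∈ Finset.range (⌊1 / (4 * (q * R))⌋₊ * q),
        ‖(y : UnitAddCircle) + k • (α : UnitAddCircle)‖⁻¹ := by
  have hqR : (1 : ℝ) ≤ q := by exact_mod_cast hq
  have hlog : 0 ≤ Real.log q := Real.log_nonneg hqR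
  have hr : 0 < q * R := by positivity
  set M := ⌊1 / (4 * (q * R))⌋₊
  set J := ⌊τ / (q * R)⌋₊
  have hM : M * (q * R) ≤ 1 / 4 := by
    have : (M : ℝ) ≤ 1 / (4 * (q * R)) := Nat.floor_le (by positivity)
    rw [le_div_iff₀ (by positivity)] at this
    linarith
  have hM' : 1 / 4 < (M + 1) * (q * R) := by
    have : 1 / (4 * (q * R)) < M + 1 := Nat.lt_floor_add_one _
    rw [div_lt_iff₀ (by positivity)] at this
    linarith
  have hJ : J * (q * R) ≤ τ := (le_div_iff₀ hr).1 (Nat.floor_le (by positivity))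
  have hJ' : τ < (J + 1) * (q * R) := (div_lt_iff₀ hr).1 (Nat.lt_floor_add_one _)
  have hJM : J + 1 ≤ M := by
    have h : (J : ℝ) * (q * R) < M * (q * R) := by linarith
    have := lt_of_mul_lt_mul_right h hr.le
    exact_mod_cast this
  obtain ⟨N, hN⟩ := Nat.exists_eq_add_of_le hJM
  have hNc : (M : ℝ) = J + 1 + N := by exact_mod_cast hN
  have hlow := le_sum_inv_norm (N := N) hq hp hs hα hR hJ hJ' (by rw [← hNc]; exact hM) hy
  have hup := sum_inv_norm_le (b := b) hq hp hs hα hR hM hτ0 (by linarith) hy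
  rw [← hN] at hlow
  refine lt_of_le_of_lt (mul_le_mul_of_nonneg_left hup hK0.le) (lt_of_lt_of_le ?_ hlow)
  rw [lt_div_iff₀ hR]
  have h1 : Real.log (1 / (8 * (q * R))) ≤ Real.log (N + 2) := by
    refine Real.log_le_log (by positivity) ?_
    rw [div_le_iff₀ (by positivity)]
    rw [hNc] at hM'
    linarith
  have h2 : (M : ℝ) * (16 * q * (1 + Real.log q)) * R ≤ 4 * (1 + Real.log q) := by
    have := mul_le_mul_of_nonneg_right hM (show 0 ≤ 16 * (1 + Real.log q) by positivity)
    linarith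
  have h3 := mul_le_mul_of_nonneg_left h2 hK0.le
  linarith

theorem volume_nsmul_preimage_closedBall {q : ℕ} (hq : 1 < q) (z : UnitAddCircle) :
    MeasureTheory.volume {x : UnitAddCircle | q • x ∈ Metric.closedBall z (1 / 32)} =
      ENNReal.ofReal (1 / 16) := by
  have h := (AddCircle.ergodic_nsmul (T := 1) hq).toMeasurePreserving.measure_preimage
    (s := Metric.closedBall z (1 / 32)) Metric.isClosed_closedBall.measurableSet.nullMeasurableSet
  rw [AddCircle.volume_closedBall] at h
  norm_num at h ⊢
  exact h

theorem exists_lift_of_nsmul_mem_closedBall {q : ℕ} {s : ℝ} (hs : |s| = 1) {x : UnitAddCircle}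
    (hx : q • x ∈ Metric.closedBall ((-(s * (3 / 32)) : ℝ) : UnitAddCircle) (1 / 32)) :
    ∃ (y τ : ℝ) (c : ℤ), x = y ∧ 0 ≤ τ ∧ τ ≤ 1 / 8 ∧ q * y = c - s * τ := by
  obtain ⟨y, rfl⟩ := QuotientAddGroup.mk_surjective x
  change q • (y : UnitAddCircle) ∈ _ at hx
  rw [Metric.mem_closedBall, dist_eq_norm, ← AddCircle.coe_nsmul, ← AddCircle.coe_sub,
    UnitAddCircle.norm_eq, nsmul_eq_mul] at hx
  set c := round (q * y - -(s * (3 / 32)))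
  have hss : s * s = 1 := by rw [← abs_mul_abs_self, hs, one_mul]
  have h : |s * (c - q * y) - 3 / 32| ≤ 1 / 32 := by
    have : s * (c - q * y) - 3 / 32 = -s * (q * y - -(s * (3 / 32)) - c) := by
      linear_combination (3 / 32) * hss
    rw [this, abs_mul, abs_neg, hs, one_mul]
    exact hx
  obtain ⟨h1, h2⟩ := abs_le.1 h
  refine ⟨y, s * (c - q * y), c, rfl, by linarith, by linarith, ?_⟩
  linear_combination (c - q * y) * hss

theorem exists_norm_coe_div_sub_le {q : ℕ} (hq : 1 ≤ q) (β₀ : UnitAddCircle) :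
    ∃ b : ℤ, ‖(((b + 1 / 2) / q : ℝ) : UnitAddCircle) - β₀‖ ≤ 1 / q := by
  have hqR : (0 : ℝ) < q := by exact_mod_cast hq
  obtain ⟨y, rfl⟩ := QuotientAddGroup.mk_surjective β₀
  refine ⟨⌊q * y⌋, ?_⟩
  change ‖_ - (y : UnitAddCircle)‖ ≤ _
  rw [← AddCircle.coe_sub, UnitAddCircle.norm_eq]
  refine (round_le _ 0).trans ?_
  have h1 := Int.floor_le (q * y)
  have h2 := Int.lt_floor_add_one (q * y)
  rw [Int.cast_zero, sub_zero, div_sub' hqR.ne', abs_div, abs_of_pos hqR]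
  gcongr
  rw [abs_le]
  constructor <;> linarith

theorem exists_cfrho_small {α : ℝ} (hα : Irrational α)
    (hLiou : ∀ k : ℝ, 0 < k → ∀ N : ℕ, ∃ n ≥ N, (cfq α n : ℝ) ^ k < (cfa α (n + 1) : ℝ))
    {K : ℝ} (hK : 1 < K) (Q : ℕ) :
    ∃ n, Q ≤ cfq α n ∧ 16 * (cfq α n * |cfrho α n|) ≤ 1 ∧
      K * (4 * (1 + Real.log (cfq α n))) <
        Real.log (1 / (8 * (cfq α n * |cfrho α n|))) - 1 := by
  obtain ⟨n, hn, h⟩ := hLiou (8 * K + 4) (by linarith) (max Q 16)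
  have hqn := (le_cfq hα n).1
  refine ⟨n, by omega, ?_⟩
  have hq : (16 : ℝ) ≤ cfq α n := by exact_mod_cast (show 16 ≤ cfq α n by omega)
  have hq0 : (0 : ℝ) < cfq α n := by linarith
  set q : ℝ := (cfq α n : ℝ)
  have hr : 0 < |cfrho α n| := abs_pos.2 (cfrho_ne_zero hα n)
  have hle : |cfrho α n| * q ^ (8 * K + 4) ≤ 1 :=
    le_trans (mul_le_mul_of_nonneg_left (h.le.trans (cfa_succ_le hα n)) hr.le)
      (abs_cfrho_mul_cfQuot_le_one hα n)
  set r := |cfrho α n|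
  have hlog8 : Real.log 8 ≤ Real.log q := Real.log_le_log (by norm_num) (by linarith)
  have hlog : 1 ≤ Real.log q := by
    rw [Real.le_log_iff_exp_le hq0]
    linarith [Real.exp_one_lt_d9]
  have hlogr : Real.log r + (8 * K + 4) * Real.log q ≤ 0 := by
    rw [← Real.log_rpow hq0, ← Real.log_mul hr.ne' (by positivity)]
    exact Real.log_nonpos (by positivity) hle
  constructor
  · have h2 : q ^ (2 : ℝ) ≤ q ^ (8 * K + 4) :=
      Real.rpow_le_rpow_of_exponent_le (by linarith) (by linarith)
    rw [Real.rpow_two] at h2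
    nlinarith [mul_le_mul_of_nonneg_left h2 hr.le, mul_pos hq0 hr]
  · rw [one_div, Real.log_inv, Real.log_mul (by norm_num) (by positivity),
      Real.log_mul hq0.ne' hr.ne']
    nlinarith

/-- Let `α` be a Liouville number, i.e. for every `k > 0`
there are infinitely many `n` with `a_{n+1} > qₙ^k`.  Then for every `K > 1`,
every `β₀ ∈ T` and every `ε > 0` there exist `m ≥ 1` and `β ∈ T` with
`‖β − β₀‖ ≤ ε` such that the set of `x ∈ T` with
`Σ_{k<m} ‖x + kα‖⁻¹ > K Σ_{k<m} ‖x + kα − β‖⁻¹` has Haar measure `≥ 1/16`. -/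
theorem stmt_15 (α : ℝ) (hα : Irrational α)
    (hLiou : ∀ k : ℝ, 0 < k → ∀ N : ℕ, ∃ n ≥ N,
      (cfq α n : ℝ) ^ k < (cfa α (n + 1) : ℝ))
    (K : ℝ) (hK : 1 < K) (β₀ : UnitAddCircle) (ε : ℝ) (hε : 0 < ε) :
    ∃ m : ℕ, 1 ≤ m ∧ ∃ β : UnitAddCircle, ‖β - β₀‖ ≤ ε ∧
      ENNReal.ofReal (1 / 16) ≤ MeasureTheory.volume
        {x : UnitAddCircle |
          K * ∑ k ∈ Finset.range m, ‖x + k • (α : UnitAddCircle) - β‖⁻¹ <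
            ∑ k ∈ Finset.range m, ‖x + k • (α : UnitAddCircle)‖⁻¹} := by
  obtain ⟨Q, hQ⟩ := exists_nat_gt (1 / ε)
  obtain ⟨n, hn, hR', hlog⟩ := exists_cfrho_small hα hLiou hK (max Q 2)
  have hq2 : 1 < cfq α n := by omega
  have hqQ : (Q : ℝ) ≤ cfq α n := by exact_mod_cast (show Q ≤ cfq α n by omega)
  have hqpos : (0 : ℝ) < cfq α n := by exact_mod_cast (zero_lt_one.trans hq2)
  have hR : 0 < |cfrho α n| := abs_pos.2 (cfrho_ne_zero hα n)
  obtain ⟨s, hs, hsR⟩ : ∃ s : ℝ, |s| = 1 ∧ cfrho α n = s * |cfrho α n| := by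
    rcases abs_choice (cfrho α n) with h | h
    · exact ⟨1, by simp, by rw [h, one_mul]⟩
    · exact ⟨-1, by simp, by rw [h]; ring⟩
  obtain ⟨b, hb⟩ := exists_norm_coe_div_sub_le hq2.le β₀
  refine ⟨⌊1 / (4 * (cfq α n * |cfrho α n|))⌋₊ * cfq α n, ?_, _, hb.trans ?_, ?_⟩
  · refine Nat.mul_pos (Nat.floor_pos.2 ?_) (by omega)
    rw [le_div_iff₀ (by positivity)]
    linarith
  · rw [div_le_iff₀ hqpos]
    rw [div_lt_iff₀ hε] at hQ
    nlinarith
  · rw [← volume_nsmul_preimage_closedBall hq2 ((-(s * (3 / 32)) : ℝ) : UnitAddCircle)]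
    refine MeasureTheory.measure_mono fun x hx => ?_
    obtain ⟨y, τ, c, rfl, hτ0, hτ, hy⟩ := exists_lift_of_nsmul_mem_closedBall hs hx
    refine mul_sum_inv_norm_lt hq2.le (isCoprime_cfp_cfq α n) hs ?_ hR hR' (by linarith) hlog
      hτ0 hτ hy
    rw [← hsR, cfrho]
    ring
end
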